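/- There is a constant C > 0 such that for every weighted path augmentation (WPAP) instance and every prediction X̂ : Finset (Fin n), there exists a randomized online algorithm μ (a PMF on maps List (Fin n) → Finset L whose support consists of deterministic online algorithms) satisfying, for every duplicate-free request sequence σ, E_{A∼μ}[c(A σ)] ≤ C · (1 + log(1 + log(1 + η(σ)))) · opt(σ.toFinset), where log is the natural logarithm. -/

import Mathlib

open Finset

/-- A weighted path augmentation (WPAP) instance on path edges `Fin n` with links `L`. -/
structure WPAPInstance (n : ℕ) (L : Type) [Fintype L] [DecidableEq L] where
  lo : L → Fin n
  hi : L → Fin n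
  lo_le_hi : ∀ ℓ, lo ℓ ≤ hi ℓ
  cost : L → ℝ
  cost_nonneg : ∀ ℓ, 0 ≤ cost ℓ
  covered : ∀ e : Fin n, ∃ ℓ : L, lo ℓ ≤ e ∧ e ≤ hi ℓ

variable {n : ℕ} {L : Type} [Fintype L] [DecidableEq L]

/-- Cost of a finite set of links. -/
def WPAPInstance.setCost (I : WPAPInstance n L) (T : Finset L) : ℝ :=
  ∑ ℓ ∈ T, I.cost ℓ

/-- `T` covers `A` if every element of `A` lies in the interval of some chosen link. -/
def WPAPInstance.Covers (I : WPAPInstance n L) (T : Finset L) (A : Finset (Fin n)) : Prop :=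
  ∀ e ∈ A, ∃ ℓ ∈ T, I.lo ℓ ≤ e ∧ e ≤ I.hi ℓ

/-- Optimum cost of covering a finite set of elements. -/
noncomputable def WPAPInstance.optCost (I : WPAPInstance n L) (A : Finset (Fin n)) : ℝ :=
  sInf {r : ℝ | ∃ T : Finset L, I.Covers T A ∧ r = I.setCost T}

/-- A deterministic online algorithm: prefix-monotone and always covering. -/
def WPAPInstance.IsOnlineAlg (I : WPAPInstance n L) (ALG : List (Fin n) → Finset L) : Prop :=
  (∀ (σ : List (Fin n)) (x : Fin n), ALG σ ⊆ ALG (σ ++ [x])) ∧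
  ∀ σ : List (Fin n), I.Covers (ALG σ) σ.toFinset

/-- The prediction error η(σ) = min(|Xσ|, |Xσ \ X̂| + |X̂ \ Xσ|). -/
def predErr (Xhat : Finset (Fin n)) (σ : List (Fin n)) : ℕ :=
  min σ.toFinset.card ((σ.toFinset \ Xhat).card + (Xhat \ σ.toFinset).card)


open Classical in
noncomputable def grd (P : ℕ → Prop) (Q : ℕ → ℕ → Prop) : ℕ → ℕ
  | 0 => 0
  | e + 1 => if P (e + 1) ∧ ¬ Q (grd P Q e) (e + 1) then e + 1 else grd P Q e

lemma grd_le (P : ℕ → Prop) (Q : ℕ → ℕ → Prop) (e : ℕ) : grd P Q e ≤ e := by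
  induction e with
  | zero => simp [grd]
  | succ e ih => rw [grd]; split_ifs <;> omega

lemma grd_between (P : ℕ → Prop) (Q : ℕ → ℕ → Prop) (e : ℕ) :
    ∀ a, grd P Q e ≤ a → a ≤ e → grd P Q a = grd P Q e := by
  induction e with
  | zero => intro a _ h; have : a = 0 := by omega
            rw [this]
  | succ e ih =>
    intro a h1 h2
    rcases Nat.lt_or_ge e a with h | h
    · have : a = e + 1 := by omega
      rw [this]
    · rw [grd] at h1 ⊢
      split_ifs at h1 ⊢ with hc
      · omega
      · exact ih a h1 h

lemma grd_mono (P : ℕ → Prop) (Q : ℕ → ℕ → Prop) : Monotone (grd P Q) := by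
  apply monotone_nat_of_le_succ
  intro e
  have := grd_le P Q e
  rw [grd]; split_ifs <;> omega

lemma grd_break (P : ℕ → Prop) (Q : ℕ → ℕ → Prop) (e : ℕ) (h : grd P Q (e+1) = e + 1) :
    P (e+1) ∧ ¬ Q (grd P Q e) (e + 1) := by
  rw [grd] at h
  split_ifs at h with hc
  · exact hc
  · have := grd_le P Q e; omega

lemma grd_nobreak (P : ℕ → Prop) (Q : ℕ → ℕ → Prop) (e : ℕ) (h : grd P Q (e+1) ≠ e + 1) :
    grd P Q (e+1) = grd P Q e ∧ (P (e+1) → Q (grd P Q e) (e + 1)) := by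
  rw [grd] at h ⊢
  split_ifs at h ⊢ with hc
  · exact absurd rfl h
  · exact ⟨rfl, fun hp => by by_contra hq; exact hc ⟨hp, hq⟩⟩

def lkd (I : WPAPInstance n L) (r : ℝ) (a b : ℕ) : Prop :=
  ∃ ℓ : L, I.cost ℓ ≤ r ∧ (I.lo ℓ : ℕ) ≤ a ∧ b ≤ (I.hi ℓ : ℕ)

noncomputable def Sst (I : WPAPInstance n L) (lam : ℝ) : ℕ → ℕ → ℕ
  | 0 => id
  | j + 1 => grd (fun e => Sst I lam j e = e) (lkd I (lam * 2 ^ j))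

lemma Sst_le (I : WPAPInstance n L) (lam : ℝ) (j e : ℕ) : Sst I lam j e ≤ e := by
  cases j with
  | zero => simp [Sst]
  | succ j => exact grd_le _ _ _

lemma Sst_between (I : WPAPInstance n L) (lam : ℝ) (j e a : ℕ) (h1 : Sst I lam j e ≤ a)
    (h2 : a ≤ e) : Sst I lam j a = Sst I lam j e := by
  cases j with
  | zero => simp [Sst] at *; omega
  | succ j => exact grd_between _ _ _ a h1 h2

lemma Sst_mono (I : WPAPInstance n L) (lam : ℝ) (j : ℕ) : Monotone (Sst I lam j) := by
  cases j with
  | zero => simp only [Sst]; exact monotone_id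
  | succ j => exact grd_mono _ _

lemma Sst_idem (I : WPAPInstance n L) (lam : ℝ) (j e : ℕ) :
    Sst I lam j (Sst I lam j e) = Sst I lam j e :=
  Sst_between I lam j e _ le_rfl (Sst_le I lam j e)

lemma Sst_step (I : WPAPInstance n L) (lam : ℝ) (j e : ℕ) :
    Sst I lam (j+1) (Sst I lam j e) = Sst I lam (j+1) e := by
  induction e with
  | zero => have := Sst_le I lam j 0; rw [Nat.le_zero.mp this]
  | succ e ih =>
    by_cases h : Sst I lam j (e+1) = e + 1
    · rw [h]
    · have hlt : Sst I lam j (e+1) ≤ e := by have := Sst_le I lam j (e+1); omega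
      have h1 := Sst_between I lam j (e+1) e hlt (by omega)
      rw [← h1, ih]
      have : grd (fun e => Sst I lam j e = e) (lkd I (lam * 2 ^ j)) (e+1) =
        grd (fun e => Sst I lam j e = e) (lkd I (lam * 2 ^ j)) e := by
        conv_lhs => rw [grd]
        rw [if_neg]
        rintro ⟨h2, _⟩
        exact h h2
      exact this.symm

lemma Sst_lam (I : WPAPInstance n L) (lam : ℝ) (j j' e f : ℕ) (hj : j ≤ j')
    (h : Sst I lam j e = Sst I lam j f) : Sst I lam j' e = Sst I lam j' f := by
  induction j', hj using Nat.le_induction with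
  | base => exact h
  | succ k _ ih => rw [← Sst_step I lam k e, ← Sst_step I lam k f, ih]

lemma setCost_insert_le (I : WPAPInstance n L) (ℓ : L) (T : Finset L) :
    I.setCost (insert ℓ T) ≤ I.cost ℓ + I.setCost T := by
  unfold WPAPInstance.setCost
  by_cases h : ℓ ∈ T
  · rw [Finset.insert_eq_of_mem h]; linarith [I.cost_nonneg ℓ]
  · rw [Finset.sum_insert h]

lemma setCost_union_le (I : WPAPInstance n L) (S T : Finset L) :
    I.setCost (S ∪ T) ≤ I.setCost S + I.setCost T := by
  unfold WPAPInstance.setCost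
  have := Finset.sum_union_inter (s₁ := S) (s₂ := T) (f := I.cost)
  have h2 : 0 ≤ ∑ ℓ ∈ S ∩ T, I.cost ℓ := Finset.sum_nonneg fun i _ => I.cost_nonneg i
  linarith

lemma setCost_nonneg (I : WPAPInstance n L) (S : Finset L) : 0 ≤ I.setCost S :=
  Finset.sum_nonneg fun i _ => I.cost_nonneg i

lemma Sst_cover (I : WPAPInstance n L) (lam : ℝ) (hl : 0 < lam) (j : ℕ) : ∀ b : ℕ,
    ∃ N : Finset L, I.setCost N ≤ lam * (2 ^ j - 1) ∧
      ∀ e : Fin n, Sst I lam j e = b → (e : ℕ) ≠ b → ∃ ℓ ∈ N, I.lo ℓ ≤ e ∧ e ≤ I.hi ℓ := by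
  induction j with
  | zero =>
    intro b
    exact ⟨∅, by simp [WPAPInstance.setCost], fun e h1 h2 => absurd h1 h2⟩
  | succ j ih =>
    intro b
    classical
    have hpow : (1:ℝ) ≤ 2 ^ j := one_le_pow₀ (by norm_num)
    have hpow2 : (2:ℝ) ^ (j+1) = 2 * 2 ^ j := by ring
    by_cases hne : ∃ e : Fin n, Sst I lam (j+1) e = b ∧ (e : ℕ) ≠ b
    swap
    · refine ⟨∅, ?_, fun e h1 h2 => absurd ⟨e, h1, h2⟩ hne⟩
      simp [WPAPInstance.setCost]
      have : 0 ≤ lam * (2 ^ (j+1) - 1) := mul_nonneg hl.le (by linarith)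
      exact this
    set F : Finset (Fin n) := Finset.univ.filter fun e => Sst I lam (j+1) e = b ∧ (e : ℕ) ≠ b with hF
    have hFne : F.Nonempty := by
      obtain ⟨e, he⟩ := hne
      exact ⟨e, by simp [hF, he]⟩
    obtain ⟨m, hm, hmax⟩ := F.exists_max_image id hFne
    simp only [hF, Finset.mem_filter, Finset.mem_univ, true_and, id] at hm hmax
    set s := Sst I lam j m with hs
    have hsb : Sst I lam (j+1) s = b := by rw [hs, Sst_step]; exact hm.1
    have hbs : b ≤ s := by rw [← hsb]; exact Sst_le _ _ _ _
    clear_value s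
    obtain ⟨N, hN1, hN2⟩ := ih s
    rcases Nat.eq_or_lt_of_le hbs with h | h
    · refine ⟨N, hN1.trans (mul_le_mul_of_nonneg_left (by linarith) hl.le), ?_⟩
      intro e h1 h2
      refine hN2 e ?_ (by omega)
      have h3 : Sst I lam j e ≤ s := by rw [hs]; exact Sst_mono I lam j (hmax e ⟨h1, h2⟩)
      have h4 : b ≤ Sst I lam j e := by
        rw [← h1, ← Sst_step]; exact Sst_le _ _ _ _
      omega
    · obtain ⟨s', rfl⟩ : ∃ s', s = s' + 1 := ⟨s - 1, by omega⟩
      have hnb := grd_nobreak (fun e => Sst I lam j e = e) (lkd I (lam * 2 ^ j)) s'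
        (by
          have : Sst I lam (j+1) (s'+1) ≠ s' + 1 := by omega
          exact this)
      have hP : Sst I lam j (s'+1) = s'+1 := by rw [hs]; exact Sst_idem _ _ _ _
      obtain ⟨ℓ, hc, hlo, hhi⟩ := hnb.2 hP
      have hb' : grd (fun e => Sst I lam j e = e) (lkd I (lam * 2 ^ j)) s' = b := by
        rw [← hnb.1]; exact hsb
      rw [hb'] at hlo
      refine ⟨insert ℓ N, ?_, ?_⟩
      · have := setCost_insert_le I ℓ N
        rw [hpow2]; nlinarith
      · intro e h1 h2
        have hbe : b ≤ e := by rw [← h1]; exact Sst_le _ _ _ _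
        rcases le_or_gt (e : ℕ) (s'+1) with h3 | h3
        · refine ⟨ℓ, Finset.mem_insert_self _ _, ?_, ?_⟩
          · rw [Fin.le_def]; omega
          · rw [Fin.le_def]; omega
        · have h4 : (e:ℕ) ≤ m := hmax e ⟨h1, h2⟩
          have h5 := Sst_between I lam j m e (by omega) h4
          obtain ⟨ℓ', h6, h7⟩ := hN2 e (by rw [h5]; exact hs.symm) (by omega)
          exact ⟨ℓ', Finset.mem_insert_of_mem h6, h7⟩

lemma Sst_meet (I : WPAPInstance n L) (lam : ℝ) (j : ℕ) (ℓ : L) (hc : I.cost ℓ ≤ lam * 2 ^ j) :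
    ((Finset.univ.filter fun e : Fin n => I.lo ℓ ≤ e ∧ e ≤ I.hi ℓ).image
      fun e : Fin n => Sst I lam (j+1) e).card ≤ 2 := by
  classical
  set g := Sst I lam (j+1) with hg
  have huniq : ∀ p p' : ℕ, g p = p → g p' = p' → (I.lo ℓ : ℕ) ≤ p → p < p' → p' ≤ I.hi ℓ → False := by
    intro p p' h1 h2 h3 h4 h5
    obtain ⟨q, rfl⟩ : ∃ q, p' = q + 1 := ⟨p' - 1, by omega⟩
    have hb := grd_break (fun e => Sst I lam j e = e) (lkd I (lam * 2 ^ j)) q h2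
    apply hb.2
    refine ⟨ℓ, hc, ?_, h5⟩
    have : g p ≤ g q := Sst_mono I lam (j+1) (by omega)
    have h6 : g q = grd (fun e => Sst I lam j e = e) (lkd I (lam * 2 ^ j)) q := rfl
    omega
  by_cases hp : ∃ p, g p = p ∧ (I.lo ℓ : ℕ) ≤ p ∧ p ≤ I.hi ℓ
  · obtain ⟨p, hp1, hp2, hp3⟩ := hp
    refine (Finset.card_le_card (t := {g (I.lo ℓ), p}) ?_).trans Finset.card_le_two
    intro x hx
    simp only [Finset.mem_image, Finset.mem_filter, Finset.mem_univ, true_and] at hx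
    obtain ⟨e, ⟨h1, h2⟩, rfl⟩ := hx
    rw [Fin.le_def] at h1 h2
    simp only [Finset.mem_insert, Finset.mem_singleton]
    rcases lt_or_ge (g e) (I.lo ℓ) with h | h
    · left; exact (Sst_between I lam (j+1) e _ h.le h1).symm
    · right
      have h3 : g (g e) = g e := Sst_idem _ _ _ _
      have h4 : g e ≤ e := Sst_le _ _ _ _
      rcases lt_trichotomy (g e) p with h5 | h5 | h5
      · exact (huniq _ _ h3 hp1 h h5 hp3).elim
      · exact h5
      · exact (huniq _ _ hp1 h3 hp2 h5 (h4.trans h2)).elim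
  · refine (Finset.card_le_card (t := {g (I.lo ℓ)}) ?_).trans (by simp)
    intro x hx
    simp only [Finset.mem_image, Finset.mem_filter, Finset.mem_univ, true_and] at hx
    obtain ⟨e, ⟨h1, h2⟩, rfl⟩ := hx
    rw [Fin.le_def] at h1 h2
    simp only [Finset.mem_singleton]
    rcases lt_or_ge (g e) (I.lo ℓ) with h | h
    · exact (Sst_between I lam (j+1) e _ h.le h1).symm
    · exact (hp ⟨g e, Sst_idem _ _ _ _, h, (Sst_le I lam (j+1) e).trans h2⟩).elim

structure HData (I : WPAPInstance n L) where
  m : ℕ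
  cl : Fin m → ℝ
  cl_pos : ∀ j, 0 < cl j
  cl_mono : Monotone cl
  cls : Fin m → Fin n → ℕ
  lami : ∀ j j' e f, j ≤ j' → cls j e = cls j f → cls j' e = cls j' f
  c : Fin n → ℝ
  ml : Fin n → L
  ml_cov : ∀ e, I.lo (ml e) ≤ e ∧ e ≤ I.hi (ml e)
  ml_cost : ∀ e, I.cost (ml e) = c e
  N : Fin m → ℕ → Finset L
  N_cost : ∀ j b, I.setCost (N j b) ≤ 3 * cl j
  N_cov : ∀ j e, c e ≤ cl j → ∃ ℓ ∈ N j (cls j e), I.lo ℓ ≤ e ∧ e ≤ I.hi ℓ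
  w : Fin m → Fin n → ℝ
  w_nonneg : ∀ j e, 0 ≤ w j e
  w_sum : ∀ e, ∑ j, w j e ≤ 2

namespace HData

variable {I : WPAPInstance n L} (D : HData I)

lemma c_nonneg (e : Fin n) : 0 ≤ D.c e := by rw [← D.ml_cost]; exact I.cost_nonneg _

noncomputable def xe (x : Fin D.m → ℕ → ℝ) (e : Fin n) (j : Fin D.m) : ℝ :=
  open Classical in if D.c e ≤ D.cl j then x j (D.cls j e) else 0

noncomputable def yv (x : Fin D.m → ℕ → ℝ) (e : Fin n) : ℝ :=
  D.c e * ∏ j, (1 - D.xe x e j)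

noncomputable def xs : List (Fin n) → Fin D.m → ℕ → ℝ
  | [] => fun _ _ => 0
  | e :: l => fun j b => open Classical in
      if D.c e ≤ D.cl j ∧ D.cls j e = b then
        min 1 (xs l j b + (xs l j b + D.w j e) * D.yv (xs l) e / D.cl j) else xs l j b

noncomputable def ys : List (Fin n) → Fin n → ℝ
  | [] => fun _ => 0
  | e :: l => fun f => ys l f + if f = e then D.yv (D.xs l) e else 0

def newtop (τ : Fin D.m → ℝ) (x x' : Fin D.m → ℕ → ℝ) (e : Fin n) (j : Fin D.m) : Prop :=
  τ j ≤ D.xe x' e j ∧ ¬ τ j ≤ D.xe x e j ∧ ∀ j', j < j' → ¬ τ j' ≤ D.xe x' e j'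

noncomputable def buy (τ : Fin D.m → ℝ) (x x' : Fin D.m → ℕ → ℝ) (e : Fin n) : Finset L :=
  open Classical in
  (if ∀ j, ¬ τ j ≤ D.xe x' e j then {D.ml e} else ∅) ∪
    (Finset.univ.filter fun j => D.newtop τ x x' e j).biUnion fun j => D.N j (D.cls j e)

noncomputable def alg (τ : Fin D.m → ℝ) : List (Fin n) → Finset L
  | [] => ∅
  | e :: l => alg τ l ∪ D.buy τ (D.xs l) (D.xs (e :: l)) e

lemma xe_mem (x : Fin D.m → ℕ → ℝ) (hx : ∀ j b, 0 ≤ x j b ∧ x j b ≤ 1) (e : Fin n) (j : Fin D.m) :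
    0 ≤ D.xe x e j ∧ D.xe x e j ≤ 1 := by
  unfold xe; split_ifs
  · exact hx _ _
  · simp

lemma yv_nonneg (x : Fin D.m → ℕ → ℝ) (hx : ∀ j b, 0 ≤ x j b ∧ x j b ≤ 1) (e : Fin n) :
    0 ≤ D.yv x e :=
  mul_nonneg (D.c_nonneg e) (Finset.prod_nonneg fun j _ => by linarith [(D.xe_mem x hx e j).2])

lemma yv_le (x : Fin D.m → ℕ → ℝ) (hx : ∀ j b, 0 ≤ x j b ∧ x j b ≤ 1) (e : Fin n) :
    D.yv x e ≤ D.c e := by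
  unfold yv
  refine mul_le_of_le_one_right (D.c_nonneg e) (Finset.prod_le_one ?_ ?_)
  · intro j _; linarith [(D.xe_mem x hx e j).2]
  · intro j _; linarith [(D.xe_mem x hx e j).1]

lemma xs_mem (l : List (Fin n)) : ∀ j b, 0 ≤ D.xs l j b ∧ D.xs l j b ≤ 1 := by
  induction l with
  | nil => intro j b; simp [xs]
  | cons e l ih =>
    intro j b
    have hy := D.yv_nonneg _ ih e
    have hw := D.w_nonneg j e
    have h1 := (ih j b).1
    have hc := D.cl_pos j
    simp only [xs]
    split_ifs
    · exact ⟨le_min zero_le_one (by positivity), min_le_left _ _⟩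
    · exact ih j b

lemma xs_step (l : List (Fin n)) (e : Fin n) (j : Fin D.m) (b : ℕ) :
    D.xs l j b ≤ D.xs (e :: l) j b := by
  have hy := D.yv_nonneg _ (D.xs_mem l) e
  have hw := D.w_nonneg j e
  have h1 := (D.xs_mem l j b).1
  have hc := D.cl_pos j
  simp only [xs]
  split_ifs
  · refine le_min (D.xs_mem l j b).2 (le_add_of_nonneg_right (by positivity))
  · exact le_rfl

lemma alg_inv (τ : Fin D.m → ℝ) (hτ : ∀ j, 0 < τ j) (l : List (Fin n)) :
    ∀ j f, D.c f ≤ D.cl j → τ j ≤ D.xs l j (D.cls j f) →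
      ∃ ℓ ∈ D.alg τ l, I.lo ℓ ≤ f ∧ f ≤ I.hi ℓ := by
  classical
  induction l with
  | nil => intro j f _ h; simp [xs] at h; linarith [hτ j]
  | cons e l ih =>
    intro j f hf h
    by_cases hold : τ j ≤ D.xs l j (D.cls j f)
    · obtain ⟨ℓ, h1, h2⟩ := ih j f hf hold
      exact ⟨ℓ, Finset.mem_union_left _ h1, h2⟩
    have hch : D.c e ≤ D.cl j ∧ D.cls j e = D.cls j f := by
      by_contra hcon
      simp only [xs] at h
      rw [if_neg hcon] at h
      exact hold h
    set E := Finset.univ.filter fun j => τ j ≤ D.xe (D.xs (e :: l)) e j with hE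
    have hjE : j ∈ E := by
      simp only [hE, Finset.mem_filter, Finset.mem_univ, true_and]
      rw [xe, if_pos hch.1, hch.2]; exact h
    obtain ⟨k, hk, hmax⟩ := E.exists_max_image id ⟨j, hjE⟩
    have hjk : j ≤ k := hmax j hjE
    have hcls : D.cls k e = D.cls k f := D.lami j k e f hjk hch.2
    have hfk : D.c f ≤ D.cl k := hf.trans (D.cl_mono hjk)
    have hek : D.c e ≤ D.cl k := hch.1.trans (D.cl_mono hjk)
    simp only [hE, Finset.mem_filter, Finset.mem_univ, true_and] at hk
    by_cases hko : τ k ≤ D.xe (D.xs l) e k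
    · rw [xe, if_pos hek, hcls] at hko
      obtain ⟨ℓ, h1, h2⟩ := ih k f hfk hko
      exact ⟨ℓ, Finset.mem_union_left _ h1, h2⟩
    · have hnt : D.newtop τ (D.xs l) (D.xs (e :: l)) e k := by
        refine ⟨hk, hko, fun j' hj' hcon => ?_⟩
        have : j' ≤ k := hmax j' (by simp [hE, hcon])
        exact absurd hj' (not_lt.mpr this)
      obtain ⟨ℓ, h1, h2⟩ := D.N_cov k f hfk
      refine ⟨ℓ, Finset.mem_union_right _ (Finset.mem_union_right _ ?_), h2⟩
      rw [Finset.mem_biUnion]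
      refine ⟨k, by simp [hnt], by rw [hcls]; exact h1⟩

lemma alg_cov (τ : Fin D.m → ℝ) (hτ : ∀ j, 0 < τ j) (l : List (Fin n)) :
    ∀ f ∈ l, ∃ ℓ ∈ D.alg τ l, I.lo ℓ ≤ f ∧ f ≤ I.hi ℓ := by
  classical
  induction l with
  | nil => simp
  | cons e l ih =>
    intro f hf
    rcases List.mem_cons.mp hf with rfl | hf
    · by_cases h : ∀ j, ¬ τ j ≤ D.xe (D.xs (f :: l)) f j
      · refine ⟨D.ml f, Finset.mem_union_right _ (Finset.mem_union_left _ ?_), D.ml_cov f⟩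
        rw [if_pos h]; simp
      · push Not at h
        obtain ⟨j, hj⟩ := h
        unfold xe at hj
        split_ifs at hj with hc
        · exact D.alg_inv τ hτ (f :: l) j f hc hj
        · exact absurd hj (not_le.mpr (hτ j))
    · obtain ⟨ℓ, h1, h2⟩ := ih f hf
      exact ⟨ℓ, Finset.mem_union_left _ h1, h2⟩

lemma alg_online (τ : Fin D.m → ℝ) (hτ : ∀ j, 0 < τ j) :
    I.IsOnlineAlg (fun σ => D.alg τ σ.reverse) := by
  constructor
  · intro σ x
    simp only [List.reverse_append, List.reverse_cons, List.reverse_nil, List.nil_append,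
      List.cons_append]
    exact Finset.subset_union_left
  · intro σ e he
    exact D.alg_cov τ hτ _ e (by simpa using he)

lemma setCost_biUnion_le {ι : Type*} [DecidableEq ι] (I : WPAPInstance n L) (s : Finset ι)
    (f : ι → Finset L) : I.setCost (s.biUnion f) ≤ ∑ i ∈ s, I.setCost (f i) := by
  induction s using Finset.induction_on with
  | empty => simp [WPAPInstance.setCost]
  | insert a s ha ih =>
    rw [Finset.biUnion_insert, Finset.sum_insert ha]
    exact (setCost_union_le I _ _).trans (by linarith)

open Classical in
lemma buy_cost (τ : Fin D.m → ℝ) (x x' : Fin D.m → ℕ → ℝ) (e : Fin n) :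
    I.setCost (D.buy τ x x' e) ≤ (if ∀ j, ¬ τ j ≤ D.xe x' e j then D.c e else 0) +
      ∑ j, if D.newtop τ x x' e j then 3 * D.cl j else 0 := by
  unfold buy
  refine (setCost_union_le I _ _).trans (add_le_add ?_ ?_)
  · split_ifs
    · simp [WPAPInstance.setCost, D.ml_cost]
    · simp [WPAPInstance.setCost]
  · refine (setCost_biUnion_le I _ _).trans ?_
    rw [Finset.sum_filter]
    refine Finset.sum_le_sum fun j _ => ?_
    split_ifs
    · exact D.N_cost _ _
    · exact le_rfl

/-- the key amortised bound -/
lemma keyA (l : List (Fin n)) (j : Fin D.m) (b : ℕ) (ω : ℝ) (hω : 0 < ω) (S : Finset (Fin n))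
    (hS : ∀ e ∈ S, D.cls j e = b ∧ D.c e ≤ D.cl j ∧ ω ≤ D.w j e) :
    (D.xs l j b < 1 → ∑ e ∈ S, D.ys l e ≤ 2 * D.cl j * Real.log ((D.xs l j b + ω) / ω)) ∧
    ∑ e ∈ S, D.ys l e ≤ D.cl j * (1 + 2 * Real.log ((1 + ω) / ω)) := by
  have hc := D.cl_pos j
  induction l with
  | nil =>
    have h0 : 0 ≤ Real.log ((1 + ω) / ω) := Real.log_nonneg (by rw [le_div_iff₀ hω]; linarith)
    simp only [ys, xs, Finset.sum_const_zero, zero_add]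
    exact ⟨fun _ => by rw [div_self hω.ne']; simp, by positivity⟩
  | cons e l ih =>
    have hstep := D.xs_step l e j b
    have hx0 := (D.xs_mem l j b)
    have hx1 := (D.xs_mem (e :: l) j b)
    have hsum : ∑ f ∈ S, D.ys (e :: l) f = ∑ f ∈ S, D.ys l f +
        (if e ∈ S then D.yv (D.xs l) e else 0) := by
      simp only [ys, Finset.sum_add_distrib, Finset.sum_ite_eq']
    rw [hsum]
    have hmono : Real.log ((D.xs l j b + ω) / ω) ≤ Real.log ((D.xs (e :: l) j b + ω) / ω) := by
      apply Real.log_le_log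
      · have := hx0.1; positivity
      · gcongr
    have hmono1 : Real.log ((D.xs l j b + ω) / ω) ≤ Real.log ((1 + ω) / ω) := by
      apply Real.log_le_log
      · have := hx0.1; positivity
      · have := hx0.2; gcongr
    by_cases heS : e ∈ S
    swap
    · rw [if_neg heS, add_zero]
      refine ⟨fun h => (ih.1 (hstep.trans_lt h)).trans ?_, ih.2⟩
      gcongr
    rw [if_pos heS]
    obtain ⟨hb, hce, hw⟩ := hS e heS
    have hy0 := D.yv_nonneg _ (D.xs_mem l) e
    have hyc := (D.yv_le _ (D.xs_mem l) e).trans hce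
    rcases hx0.2.lt_or_eq with hlt | heq
    · have hZ := ih.1 hlt
      refine ⟨fun h => ?_, ?_⟩
      · have hxe : D.xs (e :: l) j b = D.xs l j b +
            (D.xs l j b + D.w j e) * D.yv (D.xs l) e / D.cl j := by
          simp only [xs] at h ⊢
          rw [if_pos ⟨hce, hb⟩] at h ⊢
          rcases min_lt_iff.mp h with h | h
          · exact absurd h (lt_irrefl _)
          · exact min_eq_right h.le
        set s := D.yv (D.xs l) e / D.cl j with hs
        have hs0 : 0 ≤ s := by positivity
        have hs1 : s ≤ 1 := by rw [hs, div_le_one hc]; exact hyc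
        have hys : D.yv (D.xs l) e = D.cl j * s := by rw [hs]; field_simp
        have h1 : (D.xs l j b + ω) / ω * (1 + s) ≤ (D.xs (e :: l) j b + ω) / ω := by
          rw [hxe, div_mul_eq_mul_div]
          gcongr
          rw [mul_div_assoc, ← hs]
          nlinarith [mul_le_mul_of_nonneg_right hw hs0]
        have hp : 0 < (D.xs l j b + ω) / ω := by have := hx0.1; positivity
        have h2 := Real.log_le_log (by positivity) h1
        rw [Real.log_mul hp.ne' (by positivity)] at h2
        have h3 : s / 2 ≤ Real.log (1 + s) := by
          have := Real.one_sub_inv_le_log_of_pos (show 0 < 1 + s by linarith)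
          refine le_trans ?_ this
          have : 1 - (1 + s)⁻¹ = s / (1 + s) := by field_simp; ring
          rw [this]; gcongr; linarith
        rw [hys]
        nlinarith
      · nlinarith
    · have hy : D.yv (D.xs l) e = 0 := by
        unfold yv
        rw [Finset.prod_eq_zero (Finset.mem_univ j), mul_zero]
        rw [xe, if_pos hce, hb, heq]; ring
      rw [hy, add_zero]
      refine ⟨fun h => ?_, ih.2⟩
      exact absurd (heq ▸ hstep) (not_le.mpr h)

lemma ys_nonneg (l : List (Fin n)) (f : Fin n) : 0 ≤ D.ys l f := by
  induction l with
  | nil => simp [ys]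
  | cons e l ih =>
    simp only [ys]
    have := D.yv_nonneg _ (D.xs_mem l) e
    split_ifs <;> linarith

lemma ys_zero (l : List (Fin n)) (f : Fin n) (h : f ∉ l) : D.ys l f = 0 := by
  induction l with
  | nil => simp [ys]
  | cons e l ih =>
    simp only [List.mem_cons, not_or] at h
    simp [ys, h.1, ih h.2]

lemma ys_le (l : List (Fin n)) (hl : l.Nodup) (f : Fin n) : D.ys l f ≤ D.c f := by
  induction l with
  | nil => simpa [ys] using D.c_nonneg f
  | cons e l ih =>
    rw [List.nodup_cons] at hl
    simp only [ys]
    split_ifs with h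
    · subst h
      rw [D.ys_zero l f hl.1, zero_add]
      exact D.yv_le _ (D.xs_mem l) f
    · linarith [ih hl.2]

end HData

lemma exists_p (W : Finset ℝ) : (∀ w ∈ W, 0 < w) → ∃ p : ℝ → ℝ, (∀ w ∈ W, 0 ≤ p w) ∧
    (∀ x ∈ W, ∑ w ∈ W, p w * (if w ≤ x then 1 else 0) = x) ∧
    (∀ a : ℝ, 0 < a → (∀ w ∈ W, w < a) → ∑ w ∈ W, p w ≤ a) := by
  induction W using Finset.induction_on_max with
  | empty => intro _; exact ⟨fun _ => 0, by simp, by simp, fun a ha _ => by simpa using ha.le⟩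
  | insert a s ha ih =>
    intro hpos
    obtain ⟨p, h1, h2, h3⟩ := ih fun w hw => hpos w (Finset.mem_insert_of_mem hw)
    have ha0 : 0 < a := hpos a (Finset.mem_insert_self _ _)
    have hQ := h3 a ha0 ha
    have hnot : a ∉ s := fun h => lt_irrefl _ (ha a h)
    have hup : ∀ w ∈ s, Function.update p a (a - ∑ w ∈ s, p w) w = p w := fun w hw =>
      Function.update_of_ne (fun h : w = a => hnot (h ▸ hw)) _ _
    have htot : ∑ w ∈ insert a s, Function.update p a (a - ∑ w ∈ s, p w) w = a := by
      rw [Finset.sum_insert hnot, Function.update_self, Finset.sum_congr rfl hup]; ring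
    refine ⟨Function.update p a (a - ∑ w ∈ s, p w), ?_, ?_, ?_⟩
    · intro w hw
      rcases Finset.mem_insert.mp hw with rfl | hw
      · rw [Function.update_self]; linarith
      · rw [hup w hw]; exact h1 w hw
    · intro x hx
      rcases Finset.mem_insert.mp hx with rfl | hx
      · refine Eq.trans (Finset.sum_congr rfl fun w hw => ?_) htot
        rcases Finset.mem_insert.mp hw with rfl | hw
        · simp
        · rw [if_pos (ha w hw).le, mul_one]
      · rw [Finset.sum_insert hnot, if_neg (not_le.mpr (ha x hx)), mul_zero, zero_add]
        refine Eq.trans (Finset.sum_congr rfl fun w hw => ?_) (h2 x hx)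
        rw [hup w hw]
    · intro b _ hb
      rw [htot]
      exact (hb a (Finset.mem_insert_self _ _)).le

lemma exists_theta (W : Finset ℝ) (hW : ∀ w ∈ W, 0 ≤ w ∧ w ≤ 1) :
    ∃ (Θ : Type) (_ : Fintype Θ) (p t : Θ → ℝ), (∀ θ, 0 ≤ p θ) ∧ (∑ θ, p θ = 1) ∧
      (∀ θ, 0 < t θ) ∧ ∀ x ∈ W, ∑ θ, p θ * (if t θ ≤ x then 1 else 0) = x := by
  classical
  set V := (insert 1 W).filter (0 < ·) with hV
  obtain ⟨p, h1, h2, -⟩ := exists_p V (fun w hw => (Finset.mem_filter.mp hw).2)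
  have hV1 : ∀ w ∈ V, w ≤ 1 := by
    intro w hw
    rcases Finset.mem_insert.mp (Finset.mem_filter.mp hw).1 with rfl | h
    · exact le_rfl
    · exact (hW w h).2
  refine ⟨V, inferInstance, fun θ => p θ, fun θ => θ, fun θ => h1 _ θ.2, ?_,
    fun θ => (Finset.mem_filter.mp θ.2).2, ?_⟩
  · have := h2 1 (by simp [hV])
    rw [Finset.sum_coe_sort V (fun w => p w)]
    rw [← this]
    conv_rhs => rw [this]
    rw [← this]
    refine Finset.sum_congr rfl fun w hw => ?_
    rw [if_pos (hV1 w hw), mul_one]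
  · intro x hx
    rw [Finset.sum_coe_sort V (fun w => p w * (if w ≤ x then 1 else 0))]
    rcases (hW x hx).1.lt_or_eq with h | h
    · exact h2 x (by simp [hV, h, hx])
    · rw [← h]
      refine Finset.sum_eq_zero fun w hw => ?_
      rw [if_neg (not_le.mpr (Finset.mem_filter.mp hw).2), mul_zero]

lemma exists_pmf {Ω α : Type*} [Fintype Ω] (P : Ω → ℝ) (hP : ∀ ω, 0 ≤ P ω) (h1 : ∑ ω, P ω = 1)
    (g : Ω → α) : ∃ μ : PMF α, (∀ A ∈ μ.support, ∃ ω, g ω = A) ∧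
      ∀ f : α → ℝ, ∑' A, (μ A).toReal * f A = ∑ ω, P ω * f (g ω) := by
  classical
  have hs : ∑ ω, ENNReal.ofReal (P ω) = 1 := by
    rw [← ENNReal.ofReal_sum_of_nonneg fun i _ => hP i, h1, ENNReal.ofReal_one]
  refine ⟨(PMF.ofFintype (fun ω => ENNReal.ofReal (P ω)) hs).map g, ?_, ?_⟩
  · intro A hA
    rw [PMF.mem_support_map_iff] at hA
    obtain ⟨ω, -, h⟩ := hA
    exact ⟨ω, h⟩
  · intro f
    have hval : ∀ A, (((PMF.ofFintype (fun ω => ENNReal.ofReal (P ω)) hs).map g) A).toReal =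
        ∑ ω, if A = g ω then P ω else 0 := by
      intro A
      rw [PMF.map_apply, tsum_fintype, ENNReal.toReal_sum]
      · refine Finset.sum_congr rfl fun ω _ => ?_
        split_ifs
        · simp [hP]
        · simp
      · intro ω _; split_ifs <;> simp
    rw [tsum_eq_sum (s := Finset.univ.image g)]
    · simp_rw [hval, Finset.sum_mul]
      rw [Finset.sum_comm]
      refine Finset.sum_congr rfl fun ω _ => ?_
      rw [Finset.sum_eq_single (g ω)]
      · simp
      · intro b _ hb; simp [hb]
      · intro h; exact absurd (Finset.mem_image_of_mem g (Finset.mem_univ ω)) h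
    · intro A hA
      rw [hval, Finset.sum_eq_zero, zero_mul]
      intro ω _
      rw [if_neg]
      rintro rfl
      exact hA (Finset.mem_image_of_mem g (Finset.mem_univ ω))

lemma expect_prod {m : ℕ} {Θ : Type} [Fintype Θ] (p : Θ → ℝ) (φ : Fin m → Θ → ℝ) :
    ∑ ω : Fin m → Θ, (∏ j, p (ω j)) * ∏ j, φ j (ω j) = ∏ j, ∑ θ, p θ * φ j θ := by
  classical
  rw [Finset.prod_univ_sum, Fintype.piFinset_univ]
  refine Finset.sum_congr rfl fun ω _ => ?_
  rw [Finset.prod_mul_distrib]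

lemma ordered_sum {m : ℕ} (x : Fin m → ℝ) (hx : ∀ j, 0 ≤ x j ∧ x j ≤ 1) :
    ∑ j, x j * ∏ j' ∈ Finset.univ.filter (fun j' => j < j'), (1 - x j') ≤ 1 := by
  have h := Finset.prod_one_sub_ordered (ι := (Fin m)ᵒᵈ) (Finset.univ) (fun j => x (OrderDual.ofDual j))
  have h0 : 0 ≤ ∏ j ∈ (Finset.univ : Finset (Fin m)ᵒᵈ), (1 - x (OrderDual.ofDual j)) :=
    Finset.prod_nonneg fun j _ => by linarith [(hx (OrderDual.ofDual j)).2]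
  have h2 : ∑ j, x j * ∏ j' ∈ Finset.univ.filter (fun j' => j < j'), (1 - x j') =
    ∑ i : (Fin m)ᵒᵈ, x (OrderDual.ofDual i) * ∏ j ∈ Finset.univ with j < i, (1 - x (OrderDual.ofDual j)) := rfl
  linarith

namespace HData

variable {I : WPAPInstance n L} (D : HData I)

lemma step_cost {Θ : Type} [Fintype Θ] (p t : Θ → ℝ) (hp : ∀ θ, 0 ≤ p θ) (hp1 : ∑ θ, p θ = 1)
    (ht : ∀ θ, 0 < t θ)
    (l : List (Fin n)) (e : Fin n)
    (hg : ∀ j b, ∑ θ, p θ * (if t θ ≤ D.xs l j b then 1 else 0) = D.xs l j b)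
    (hg' : ∀ j b, ∑ θ, p θ * (if t θ ≤ D.xs (e :: l) j b then 1 else 0) = D.xs (e :: l) j b) :
    ∑ ω : Fin D.m → Θ, (∏ j, p (ω j)) *
      I.setCost (D.buy (fun j => t (ω j)) (D.xs l) (D.xs (e :: l)) e) ≤ 10 * D.yv (D.xs l) e := by
  classical
  set x := D.xe (D.xs l) e with hx
  set x' := D.xe (D.xs (e :: l)) e with hx'
  have hxm : ∀ j, 0 ≤ x j ∧ x j ≤ 1 := D.xe_mem _ (D.xs_mem l) e
  have hxx : ∀ j, x j ≤ x' j := by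
    intro j; simp only [hx, hx', xe]
    split_ifs
    · exact D.xs_step l e j _
    · exact le_rfl
  have hE : ∀ j, ∑ θ, p θ * (if t θ ≤ x j then 1 else 0) = x j := by
    intro j; simp only [hx, xe]
    by_cases h : D.c e ≤ D.cl j
    · simp only [if_pos h]; exact hg _ _
    · simp only [if_neg h]
      exact Finset.sum_eq_zero fun θ _ => by rw [if_neg (not_le.mpr (ht θ)), mul_zero]
  have hE' : ∀ j, ∑ θ, p θ * (if t θ ≤ x' j then 1 else 0) = x' j := by
    intro j; simp only [hx', xe]
    by_cases h : D.c e ≤ D.cl j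
    · simp only [if_pos h]; exact hg' _ _
    · simp only [if_neg h]
      exact Finset.sum_eq_zero fun θ _ => by rw [if_neg (not_le.mpr (ht θ)), mul_zero]
  have hn : ∀ j, ∑ θ, p θ * (1 - if t θ ≤ x j then 1 else 0) = 1 - x j := by
    intro j; simp only [mul_sub, mul_one, Finset.sum_sub_distrib, hE, hp1]
  have hd : ∀ j, ∑ θ, p θ * ((if t θ ≤ x' j then 1 else 0) - if t θ ≤ x j then 1 else 0) = x' j - x j := by
    intro j; simp only [mul_sub, Finset.sum_sub_distrib, hE, hE']
  have hW : ∀ ω : Fin D.m → Θ, 0 ≤ ∏ j, p (ω j) := fun ω => Finset.prod_nonneg fun j _ => hp _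
  -- leaf part
  have hA : ∑ ω : Fin D.m → Θ, (∏ j, p (ω j)) * (if ∀ j, ¬ t (ω j) ≤ x' j then D.c e else 0) ≤
      D.yv (D.xs l) e := by
    have : D.yv (D.xs l) e = D.c e * ∑ ω : Fin D.m → Θ, (∏ j, p (ω j)) *
        ∏ j, (1 - if t (ω j) ≤ x j then 1 else 0) := by
      rw [expect_prod p (fun j θ => 1 - if t θ ≤ x j then 1 else 0)]
      simp only [hn]; rfl
    rw [this, Finset.mul_sum]
    refine Finset.sum_le_sum fun ω _ => ?_
    rw [mul_left_comm]
    refine mul_le_mul_of_nonneg_left ?_ (hW ω)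
    split_ifs with h
    · rw [Finset.prod_eq_one, mul_one]
      intro j _
      rw [if_neg (fun hc => h j (hc.trans (hxx j)))]; ring
    · refine mul_nonneg (D.c_nonneg e) (Finset.prod_nonneg fun j _ => ?_)
      split_ifs <;> norm_num
  have hB : ∀ j, ∑ ω : Fin D.m → Θ, (∏ j, p (ω j)) *
      (if D.newtop (fun j => t (ω j)) (D.xs l) (D.xs (e :: l)) e j then 3 * D.cl j else 0) ≤
      3 * D.cl j * ((x' j - x j) * ∏ j' ∈ Finset.univ.filter (fun j' => j < j'), (1 - x j')) := by
    intro j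
    set φ : Fin D.m → Θ → ℝ := fun j' θ =>
      if j' = j then ((if t θ ≤ x' j' then 1 else 0) - if t θ ≤ x j' then 1 else 0)
      else if j < j' then (1 - if t θ ≤ x j' then 1 else 0) else 1 with hφ
    have hprod : ∑ ω : Fin D.m → Θ, (∏ j, p (ω j)) * ∏ j', φ j' (ω j') =
        (x' j - x j) * ∏ j' ∈ Finset.univ.filter (fun j' => j < j'), (1 - x j') := by
      rw [expect_prod p φ]
      have : ∀ j', ∑ θ, p θ * φ j' θ = (if j' = j then (x' j' - x j') else 1) *
          (if j < j' then (1 - x j') else 1) := by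
        intro j'
        simp only [hφ]
        by_cases h1 : j' = j
        · subst h1; simp only [if_true, lt_irrefl, if_false, mul_one]; exact hd j'
        · by_cases h2 : j < j'
          · simp only [if_neg h1, if_pos h2, one_mul]; exact hn j'
          · simp only [if_neg h1, if_neg h2, one_mul, mul_one]; exact hp1
      simp only [this]
      rw [Finset.prod_mul_distrib, Finset.prod_ite_eq', if_pos (Finset.mem_univ _), Finset.prod_filter]
    rw [← hprod, Finset.mul_sum]
    refine Finset.sum_le_sum fun ω _ => ?_
    rw [mul_left_comm]
    refine mul_le_mul_of_nonneg_left ?_ (hW ω)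
    have hc := D.cl_pos j
    split_ifs with h
    · rw [Finset.prod_eq_one, mul_one]
      intro j' _
      obtain ⟨h1, h2, h3⟩ := h
      simp only [hφ]
      by_cases h4 : j' = j
      · subst h4; rw [if_pos rfl, if_pos h1, if_neg h2]; ring
      · by_cases h5 : j < j'
        · rw [if_neg h4, if_pos h5, if_neg (fun hc => h3 j' h5 (hc.trans (hxx j')))]; ring
        · rw [if_neg h4, if_neg h5]
    · refine mul_nonneg (by positivity) (Finset.prod_nonneg fun j' _ => ?_)
      simp only [hφ]
      by_cases h4 : j' = j
      · rw [if_pos h4]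
        by_cases h6 : t (ω j') ≤ x j'
        · rw [if_pos h6, if_pos (h6.trans (hxx j'))]; norm_num
        · rw [if_neg h6]; split_ifs <;> norm_num
      · rw [if_neg h4]; split_ifs <;> norm_num
  have hy := D.yv_nonneg _ (D.xs_mem l) e
  have hinc : ∀ j, D.cl j * (x' j - x j) ≤ (x j + D.w j e) * D.yv (D.xs l) e := by
    intro j
    have hc := D.cl_pos j
    have hw := D.w_nonneg j e
    by_cases h : D.c e ≤ D.cl j
    · have h1 : x' j ≤ x j + (x j + D.w j e) * D.yv (D.xs l) e / D.cl j := by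
        simp only [hx, hx', xe, if_pos h]
        simp only [xs]
        rw [if_pos ⟨h, trivial⟩]
        exact min_le_right _ _
      calc D.cl j * (x' j - x j) ≤ D.cl j * ((x j + D.w j e) * D.yv (D.xs l) e / D.cl j) := by
            gcongr; linarith
        _ = _ := by field_simp
    · have : x' j = x j := by simp only [hx, hx', xe, if_neg h]
      rw [this, sub_self, mul_zero]
      have := (hxm j).1
      positivity
  have hpr : ∀ j, 0 ≤ ∏ j' ∈ Finset.univ.filter (fun j' => j < j'), (1 - x j') ∧
      ∏ j' ∈ Finset.univ.filter (fun j' => j < j'), (1 - x j') ≤ 1 := by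
    intro j
    refine ⟨Finset.prod_nonneg fun j' _ => by linarith [(hxm j').2],
      Finset.prod_le_one (fun j' _ => by linarith [(hxm j').2]) fun j' _ => by linarith [(hxm j').1]⟩
  calc _ ≤ ∑ ω : Fin D.m → Θ, (∏ j, p (ω j)) * ((if ∀ j, ¬ t (ω j) ≤ x' j then D.c e else 0) +
      ∑ j, if D.newtop (fun j => t (ω j)) (D.xs l) (D.xs (e :: l)) e j then 3 * D.cl j else 0) :=
        Finset.sum_le_sum fun ω _ => mul_le_mul_of_nonneg_left (D.buy_cost _ _ _ _) (hW ω)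
    _ = ∑ ω : Fin D.m → Θ, (∏ j, p (ω j)) * (if ∀ j, ¬ t (ω j) ≤ x' j then D.c e else 0) +
      ∑ j, ∑ ω : Fin D.m → Θ, (∏ j, p (ω j)) *
      (if D.newtop (fun j => t (ω j)) (D.xs l) (D.xs (e :: l)) e j then 3 * D.cl j else 0) := by
        simp only [mul_add, Finset.sum_add_distrib, Finset.mul_sum]
        rw [Finset.sum_comm]
    _ ≤ D.yv (D.xs l) e + ∑ j, 3 * D.yv (D.xs l) e *
        (x j * ∏ j' ∈ Finset.univ.filter (fun j' => j < j'), (1 - x j') + D.w j e) := by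
        refine add_le_add hA (Finset.sum_le_sum fun j _ => (hB j).trans ?_)
        have h1 := mul_le_mul_of_nonneg_right (hinc j) (hpr j).1
        have h2 := mul_le_mul_of_nonneg_left (hpr j).2 (mul_nonneg (D.w_nonneg j e) hy)
        nlinarith
    _ ≤ 10 * D.yv (D.xs l) e := by
        rw [← Finset.mul_sum, Finset.sum_add_distrib]
        have h1 := ordered_sum x hxm
        have h2 := D.w_sum e
        nlinarith

lemma exists_alg : ∃ μ : PMF (List (Fin n) → Finset L), (∀ A ∈ μ.support, I.IsOnlineAlg A) ∧
    ∀ σ : List (Fin n), σ.Nodup →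
      (∑' A : List (Fin n) → Finset L, (μ A).toReal * I.setCost (A σ)) ≤
        10 * ∑ e, D.ys σ.reverse e := by
  classical
  set W : Finset ℝ := (Finset.univ : Finset (({l : List (Fin n) // l.Nodup}) × Fin D.m)).biUnion
    fun q => ({0} ∪ Finset.univ.image fun e => D.xs q.1.1 q.2 (D.cls q.2 e)) with hWdef
  -- values at labels which are not classes vanish
  have hz : ∀ (l : List (Fin n)) j b, (∀ e, D.cls j e ≠ b) → D.xs l j b = 0 := by
    intro l j b hb
    induction l with
    | nil => rfl
    | cons e l ih =>
      simp only [xs]; rw [if_neg (fun h => hb e h.2)]; exact ih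
  have hWm : ∀ (l : List (Fin n)) j b, l.Nodup → D.xs l j b ∈ W := by
    intro l j b hl
    rw [hWdef, Finset.mem_biUnion]
    refine ⟨(⟨l, hl⟩, j), Finset.mem_univ _, ?_⟩
    by_cases hb : ∃ e, D.cls j e = b
    · obtain ⟨e, rfl⟩ := hb
      exact Finset.mem_union_right _ (Finset.mem_image_of_mem _ (Finset.mem_univ e))
    · push Not at hb
      rw [hz l j b hb]; simp
  obtain ⟨Θ, inst, p, t, hp, hp1, ht, hpx⟩ := exists_theta W (by
    intro w hw
    rw [hWdef, Finset.mem_biUnion] at hw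
    obtain ⟨q, -, hq⟩ := hw
    rcases Finset.mem_union.mp hq with h | h
    · rw [Finset.mem_singleton.mp h]; norm_num
    · obtain ⟨e, -, rfl⟩ := Finset.mem_image.mp h
      exact D.xs_mem _ _ _)
  have hsum1 : ∑ ω : Fin D.m → Θ, ∏ j, p (ω j) = 1 := by
    have := expect_prod (m := D.m) p (fun _ _ => 1)
    simpa [hp1] using this
  obtain ⟨μ, h1, h2⟩ := exists_pmf (fun ω : Fin D.m → Θ => ∏ j, p (ω j))
    (fun ω => Finset.prod_nonneg fun j _ => hp _) hsum1
    (fun ω (σ : List (Fin n)) => D.alg (fun j => t (ω j)) σ.reverse)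
  refine ⟨μ, ?_, ?_⟩
  · intro A hA
    obtain ⟨ω, rfl⟩ := h1 A hA
    exact D.alg_online _ fun j => ht _
  · intro σ hσ
    rw [h2 (fun A => I.setCost (A σ))]
    simp only
    have hl : σ.reverse.Nodup := List.nodup_reverse.mpr hσ
    generalize σ.reverse = l at hl
    induction l with
    | nil => simp [alg, ys, WPAPInstance.setCost]
    | cons e l ih =>
      have ih' := ih (List.nodup_cons.mp hl).2
      have hs := D.step_cost p t hp hp1 ht l e
        (fun j b => hpx _ (hWm _ _ _ (List.nodup_cons.mp hl).2))
        (fun j b => hpx _ (hWm _ _ _ hl))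
      have hy : ∑ f, D.ys (e :: l) f = ∑ f, D.ys l f + D.yv (D.xs l) e := by
        simp only [ys, Finset.sum_add_distrib, Finset.sum_ite_eq', Finset.mem_univ, if_true]
      rw [hy, mul_add]
      refine le_trans ?_ (add_le_add ih' hs)
      rw [← Finset.sum_add_distrib]
      refine Finset.sum_le_sum fun ω _ => ?_
      rw [← mul_add]
      exact mul_le_mul_of_nonneg_left (setCost_union_le I _ _)
        (Finset.prod_nonneg fun j _ => hp _)

end HData

namespace HData

lemma opt_le (I : WPAPInstance n L) (A : Finset (Fin n)) (T : Finset L) (h : I.Covers T A) :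
    I.optCost A ≤ I.setCost T := by
  refine csInf_le ⟨0, ?_⟩ ⟨T, h, rfl⟩
  rintro r ⟨T, _, rfl⟩
  exact setCost_nonneg I T

lemma opt_att (I : WPAPInstance n L) (A : Finset (Fin n)) :
    ∃ T : Finset L, I.Covers T A ∧ I.optCost A = I.setCost T := by
  have hne : {r : ℝ | ∃ T : Finset L, I.Covers T A ∧ r = I.setCost T}.Nonempty := by
    refine ⟨_, Finset.univ, ?_, rfl⟩
    intro e _
    obtain ⟨ℓ, h⟩ := I.covered e
    exact ⟨ℓ, Finset.mem_univ _, h⟩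
  have hfin : {r : ℝ | ∃ T : Finset L, I.Covers T A ∧ r = I.setCost T}.Finite := by
    refine (Set.finite_range fun T : Finset L => I.setCost T).subset ?_
    rintro r ⟨T, _, rfl⟩
    exact ⟨T, rfl⟩
  obtain ⟨T, h1, h2⟩ := hne.csInf_mem hfin
  exact ⟨T, h1, h2⟩

lemma opt_nonneg (I : WPAPInstance n L) (A : Finset (Fin n)) : 0 ≤ I.optCost A := by
  obtain ⟨T, _, h⟩ := opt_att I A
  rw [h]; exact setCost_nonneg I T

lemma opt_mono (I : WPAPInstance n L) {A B : Finset (Fin n)} (h : A ⊆ B) :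
    I.optCost A ≤ I.optCost B := by
  obtain ⟨T, h1, h2⟩ := opt_att I B
  rw [h2]
  exact opt_le I A T fun e he => h1 e (h he)

lemma opt_union (I : WPAPInstance n L) (A B : Finset (Fin n)) :
    I.optCost (A ∪ B) ≤ I.optCost A + I.optCost B := by
  obtain ⟨T, h1, h2⟩ := opt_att I A
  obtain ⟨S, h3, h4⟩ := opt_att I B
  rw [h2, h4]
  refine (opt_le I _ (T ∪ S) ?_).trans (setCost_union_le I _ _)
  intro e he
  rcases Finset.mem_union.mp he with he | he
  · obtain ⟨ℓ, h, h'⟩ := h1 e he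
    exact ⟨ℓ, Finset.mem_union_left _ h, h'⟩
  · obtain ⟨ℓ, h, h'⟩ := h3 e he
    exact ⟨ℓ, Finset.mem_union_right _ h, h'⟩

noncomputable def smallSet {m : ℕ} (cl : Fin m → ℝ) (cls : Fin m → Fin n → ℕ) (c : Fin n → ℝ)
    (B : Finset (Fin n)) (k : ℕ) (j : Fin m) (b : ℕ) : Finset (Fin n) :=
  open Classical in B.filter fun f => cls j f = b ∧ c f * 2 ^ k < cl j

def dense (I : WPAPInstance n L) {m : ℕ} (cl : Fin m → ℝ) (cls : Fin m → Fin n → ℕ)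
    (c : Fin n → ℝ) (X : Finset (Fin n)) (k : ℕ) (j : Fin m) (b : ℕ) : Prop :=
  1 / 8 * cl j ≤ I.optCost (smallSet cl cls c X k j b)

def isTop (I : WPAPInstance n L) {m : ℕ} (cl : Fin m → ℝ) (cls : Fin m → Fin n → ℕ)
    (c : Fin n → ℝ) (X : Finset (Fin n)) (k : ℕ) (j : Fin m) (e : Fin n) : Prop :=
  dense I cl cls c X k j (cls j e) ∧ ∀ j', j < j' → ¬ dense I cl cls c X k j' (cls j' e)

noncomputable def uu (k : ℕ) : ℝ := 1 / (((k : ℝ) + 1) * ((k : ℝ) + 2))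

lemma uu_pos (k : ℕ) : 0 < uu k := by unfold uu; positivity

noncomputable def Phi (k : ℕ) : ℝ := 1 + 2 * Real.log ((1 + uu k) / uu k)

lemma Phi_ge (k : ℕ) : 1 ≤ Phi k := by
  have h := uu_pos k
  have : 0 ≤ Real.log ((1 + uu k) / uu k) := by
    apply Real.log_nonneg
    rw [le_div_iff₀ h]; linarith
  unfold Phi; linarith

structure AData {I : WPAPInstance n L} (D : HData I) (X : Finset (Fin n)) (K : ℕ) where
  j0 : Fin D.m
  lam : ℝ
  lam_pos : 0 < lam
  c_lam : ∀ e, 0 < D.c e → lam ≤ D.c e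
  c_opt : ∀ A : Finset (Fin n), ∀ e ∈ A, D.c e ≤ I.optCost A
  hO : ∀ A : Finset (Fin n), ∃ O : Finset (Fin D.m × ℕ),
    ∑ v ∈ O, D.cl v.1 ≤ 4 * I.optCost A ∧ (∀ v ∈ O, D.cl v.1 ≤ 2 * I.optCost A) ∧
    ∀ e ∈ A, 0 < D.c e → ∃ j, (j, D.cls j e) ∈ O ∧ D.c e ≤ D.cl j
  hbig : ∀ k < K, ∀ j e, D.c e ≤ D.cl j → D.cl j ≤ D.c e * 2 ^ k → uu k ≤ D.w j e
  htop : ∀ k < K, ∀ j e, isTop I D.cl D.cls D.c X k j e → uu k ≤ D.w j e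

variable {I : WPAPInstance n L} {D : HData I} {X : Finset (Fin n)} {K : ℕ}

lemma AData.hO' (H : AData D X K) (A : Finset (Fin n)) :
    ∃ (O : Finset (Fin D.m × ℕ)) (tp : Fin n → Fin D.m),
    ∑ v ∈ O, D.cl v.1 ≤ 4 * I.optCost A ∧ (∀ v ∈ O, D.cl v.1 ≤ 2 * I.optCost A) ∧
    ∀ e ∈ A, 0 < D.c e → (tp e, D.cls (tp e) e) ∈ O ∧ D.c e ≤ D.cl (tp e) ∧
      ∀ j, (j, D.cls j e) ∈ O → j ≤ tp e := by
  classical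
  obtain ⟨O, h1, h2, h3⟩ := H.hO A
  have : ∀ e : Fin n, ∃ t : Fin D.m → Fin D.m, ∀ j0 : Fin D.m, e ∈ A → 0 < D.c e → 
      (t j0, D.cls (t j0) e) ∈ O ∧ D.c e ≤ D.cl (t j0) ∧
      ∀ j, (j, D.cls j e) ∈ O → j ≤ t j0 := by
    intro e
    by_cases h : e ∈ A ∧ 0 < D.c e
    · obtain ⟨j, hj, hj'⟩ := h3 e h.1 h.2
      obtain ⟨t, ht, ht'⟩ := Finset.exists_max_image
        (Finset.univ.filter fun j => (j, D.cls j e) ∈ O) id ⟨j, by simpa using hj⟩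
      simp only [Finset.mem_filter, Finset.mem_univ, true_and, id] at ht ht'
      exact ⟨fun _ => t, fun _ _ _ => ⟨ht, hj'.trans (D.cl_mono (ht' j hj)), ht'⟩⟩
    · exact ⟨id, fun _ h1 h2 => absurd ⟨h1, h2⟩ h⟩
  choose t ht using this
  exact ⟨O, fun e => t e H.j0, h1, h2, fun e he hc => ht e H.j0 he hc⟩

lemma keyB (l : List (Fin n)) (j : Fin D.m) (b : ℕ) (k : ℕ) (S : Finset (Fin n))
    (hS : ∀ e ∈ S, D.cls j e = b ∧ D.c e ≤ D.cl j ∧ uu k ≤ D.w j e) :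
    ∑ e ∈ S, D.ys l e ≤ Phi k * D.cl j := by
  rw [mul_comm]
  exact (D.keyA l j b (uu k) (uu_pos k) S hS).2

lemma sum_ys_pos (l : List (Fin n)) (hl : l.Nodup) (A : Finset (Fin n)) :
    ∑ e ∈ A, D.ys l e = ∑ e ∈ A with 0 < D.c e, D.ys l e := by
  rw [Finset.sum_filter]
  refine Finset.sum_congr rfl fun e _ => ?_
  split_ifs with h
  · rfl
  · linarith [D.ys_le l hl e, D.ys_nonneg l e]

lemma lemU (H : AData D X K) (l : List (Fin n)) (hl : l.Nodup) (A : Finset (Fin n)) (k : ℕ)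
    (hk : k < K) (hA : A.card ≤ 2 ^ k) :
    ∑ e ∈ A, D.ys l e ≤ 8 * Phi k * I.optCost A := by
  classical
  obtain ⟨O, tp, h1, h2, h3⟩ := H.hO' A
  rw [sum_ys_pos l hl]
  rw [← Finset.sum_fiberwise_of_maps_to (t := O) (g := fun e => (tp e, D.cls (tp e) e))
    (fun e he => by
      rw [Finset.mem_filter] at he
      exact (h3 e he.1 he.2).1)]
  have key : ∀ v ∈ O, ∑ e ∈ (A.filter fun e => 0 < D.c e).filter
      (fun e => (tp e, D.cls (tp e) e) = v), D.ys l e ≤ 2 * Phi k * D.cl v.1 := by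
    rintro ⟨j, b⟩ hv
    simp only
    set F := (A.filter fun e => 0 < D.c e).filter (fun e => (tp e, D.cls (tp e) e) = (j, b)) with hF
    have hFm : ∀ e ∈ F, e ∈ A ∧ tp e = j ∧ D.cls j e = b ∧ D.c e ≤ D.cl j := by
      intro e he
      simp only [hF, Finset.mem_filter, Prod.mk.injEq] at he
      obtain ⟨⟨ha, hb⟩, hc, hd⟩ := he
      have := (h3 e ha hb).2.1
      subst hc
      exact ⟨ha, rfl, hd, this⟩
    rw [← Finset.sum_filter_add_sum_filter_not F (fun e => D.cl j ≤ D.c e * 2 ^ k)]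
    have hb := keyB (D := D) l j b k (F.filter fun e => D.cl j ≤ D.c e * 2 ^ k) (by
      intro e he
      rw [Finset.mem_filter] at he
      obtain ⟨_, _, h6, h7⟩ := hFm e he.1
      exact ⟨h6, h7, H.hbig k hk j e h7 he.2⟩)
    have hs : ∑ e ∈ F.filter (fun e => ¬ D.cl j ≤ D.c e * 2 ^ k), D.ys l e ≤ D.cl j := by
      have h4 : ∀ e ∈ F.filter (fun e => ¬ D.cl j ≤ D.c e * 2 ^ k), D.ys l e ≤ D.cl j / 2 ^ k := by
        intro e he
        rw [Finset.mem_filter, not_le] at he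
        refine (D.ys_le l hl e).trans ?_
        rw [le_div_iff₀ (by positivity)]; exact he.2.le
      refine (Finset.sum_le_card_nsmul _ _ _ h4).trans ?_
      rw [nsmul_eq_mul]
      have h5 : ((F.filter (fun e => ¬ D.cl j ≤ D.c e * 2 ^ k)).card : ℝ) ≤ 2 ^ k := by
        have : (F.filter (fun e => ¬ D.cl j ≤ D.c e * 2 ^ k)).card ≤ A.card :=
          Finset.card_le_card fun e he => (hFm e (Finset.mem_filter.mp he).1).1
        exact_mod_cast this.trans hA
      calc _ ≤ (2:ℝ) ^ k * (D.cl j / 2 ^ k) :=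
            mul_le_mul_of_nonneg_right h5 (div_nonneg (D.cl_pos j).le (by positivity))
        _ = D.cl j := by field_simp
    have hP := Phi_ge k
    nlinarith [D.cl_pos j]
  refine (Finset.sum_le_sum key).trans ?_
  rw [← Finset.mul_sum]
  have hP := Phi_ge k
  nlinarith [h1]

end HData

namespace HData

variable {I : WPAPInstance n L} {D : HData I} {X : Finset (Fin n)} {K : ℕ}

lemma opt_le_sum (A : Finset (Fin n)) : I.optCost A ≤ ∑ f ∈ A, D.c f := by
  classical
  refine (opt_le I A (A.biUnion fun f => {D.ml f}) ?_).trans ?_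
  · intro e he
    exact ⟨D.ml e, Finset.mem_biUnion.mpr ⟨e, he, Finset.mem_singleton_self _⟩, D.ml_cov e⟩
  · refine (setCost_biUnion_le I _ _).trans (Finset.sum_le_sum fun f _ => ?_)
    simp [WPAPInstance.setCost, D.ml_cost]

lemma mem_small {m : ℕ} {cl : Fin m → ℝ} {cls : Fin m → Fin n → ℕ} {c : Fin n → ℝ}
    {B : Finset (Fin n)} {k : ℕ} {j : Fin m} {b : ℕ} {f : Fin n} :
    f ∈ smallSet cl cls c B k j b ↔ f ∈ B ∧ cls j f = b ∧ c f * 2 ^ k < cl j := by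
  simp [smallSet]

lemma lemE1 (H : AData D X K) (l : List (Fin n)) (k : ℕ) (hk : k < K)
    (Y : Finset (Fin n)) (hYX : Y ⊆ X) (hcard : 16 * (X \ Y).card ≤ 2 ^ k)
    (A : Finset (Fin n)) 
    (hstar : ∀ j b, dense I D.cl D.cls D.c X k j b → (∃ e ∈ A, D.cls j e = b) →
      smallSet D.cl D.cls D.c Y k j b ⊆ A)
    (O : Finset (Fin D.m × ℕ)) (tp : Fin n → Fin D.m)
    (h3 : ∀ e ∈ A, 0 < D.c e → (tp e, D.cls (tp e) e) ∈ O ∧ D.c e ≤ D.cl (tp e) ∧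
      ∀ j, (j, D.cls j e) ∈ O → j ≤ tp e)
    (E : Finset (Fin n)) (hE : ∀ e ∈ E, e ∈ A ∧ 0 < D.c e ∧
      ∃ j, tp e ≤ j ∧ dense I D.cl D.cls D.c X k j (D.cls j e)) :
    ∑ e ∈ E, D.ys l e ≤ 48 * Phi k * ∑ v ∈ O, D.cl v.1 := by
  classical
  have hP := Phi_ge k
  have : ∀ e : Fin n, ∃ h : Fin D.m, e ∈ E → tp e ≤ h ∧ isTop I D.cl D.cls D.c X k h e := by
    intro e
    by_cases he : e ∈ E
    · obtain ⟨_, _, j, hj, hd⟩ := hE e he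
      obtain ⟨t, ht, ht'⟩ := Finset.exists_max_image
        (Finset.univ.filter fun j => dense I D.cl D.cls D.c X k j (D.cls j e)) id
        ⟨j, by simpa using hd⟩
      simp only [Finset.mem_filter, Finset.mem_univ, true_and, id] at ht ht'
      exact ⟨t, fun _ => ⟨hj.trans (ht' j hd), ht, fun j' hj' hd' => absurd (ht' j' hd') (not_le.mpr hj')⟩⟩
    · exact ⟨H.j0, fun h => absurd h he⟩
  choose h hh using this
  set G := E.image fun e => (h e, D.cls (h e) e) with hG
  rw [← Finset.sum_fiberwise_of_maps_to (t := G) (g := fun e => (h e, D.cls (h e) e))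
    (fun e he => Finset.mem_image_of_mem _ he)]
  have key1 : ∀ v ∈ G, ∑ e ∈ E.filter (fun e => (h e, D.cls (h e) e) = v), D.ys l e
      ≤ Phi k * D.cl v.1 := by
    rintro ⟨j, b⟩ _
    refine keyB l j b k _ ?_
    intro e he
    rw [Finset.mem_filter, Prod.mk.injEq] at he
    obtain ⟨he, hj, hb⟩ := he
    obtain ⟨hA, hc, _⟩ := hE e he
    have h4 := (h3 e hA hc).2.1
    have h5 := hh e he
    subst hj
    exact ⟨hb, h4.trans (D.cl_mono h5.1), H.htop k hk _ e h5.2⟩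
  refine (Finset.sum_le_sum key1).trans ?_
  rw [← Finset.mul_sum]
  let R : (Fin D.m × ℕ) → (Fin D.m × ℕ) → Prop := fun o v =>
    o.1 ≤ v.1 ∧ ∃ f, D.cls o.1 f = o.2 ∧ D.cls v.1 f = v.2
  have key2 : ∀ v ∈ G, D.cl v.1 ≤ 48 * ∑ o ∈ O, if R o v then D.cl o.1 else 0 := by
    intro v hv
    obtain ⟨e, he, rfl⟩ := Finset.mem_image.mp hv
    obtain ⟨hA, hc, _⟩ := hE e he
    obtain ⟨hte, hd, _⟩ := hh e he
    have hsub := hstar _ _ hd ⟨e, hA, rfl⟩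
    set j := h e
    simp only
    rw [← Finset.sum_filter]
    have hcov : I.optCost (smallSet D.cl D.cls D.c Y k j (D.cls j e)) ≤
        3 * ∑ o ∈ O with R o (j, D.cls j e), D.cl o.1 := by
      refine (opt_le I _ (((O.filter fun o => R o (j, D.cls j e)).biUnion fun o => D.N o.1 o.2) ∪
        ((Finset.univ.filter fun f => D.c f = 0).biUnion fun f => {D.ml f})) ?_).trans ?_
      · intro f hf
        have hfA := hsub hf
        obtain ⟨hfY, hfc, _⟩ := mem_small.mp hf
        rcases (D.c_nonneg f).lt_or_eq with hp | hp
        · obtain ⟨g1, g2, g3⟩ := h3 f hfA hp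
          have hle : tp f ≤ j := by
            by_contra hcon
            have hlt := not_le.mp hcon
            have := D.lami j (tp f) f e hlt.le hfc
            rw [this] at g1
            exact absurd (((h3 e hA hc).2.2 _ g1).trans hte) hcon
          obtain ⟨ℓ, hℓ, hℓ'⟩ := D.N_cov (tp f) f g2
          refine ⟨ℓ, Finset.mem_union_left _ (Finset.mem_biUnion.mpr
            ⟨_, Finset.mem_filter.mpr ⟨g1, hle, f, rfl, hfc⟩, hℓ⟩), hℓ'⟩
        · exact ⟨D.ml f, Finset.mem_union_right _ (Finset.mem_biUnion.mpr
            ⟨f, by simp [← hp], Finset.mem_singleton_self _⟩), D.ml_cov f⟩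
      · refine (setCost_union_le I _ _).trans ?_
        have g1 := setCost_biUnion_le I (Finset.univ.filter fun f => D.c f = 0)
          (fun f => {D.ml f})
        have g2 : ∑ f ∈ Finset.univ.filter (fun f => D.c f = 0), I.setCost {D.ml f} = 0 := by
          refine Finset.sum_eq_zero fun f hf => ?_
          simpa [WPAPInstance.setCost, D.ml_cost] using hf
        have g3 := setCost_biUnion_le I (O.filter fun o => R o (j, D.cls j e))
          (fun o => D.N o.1 o.2)
        have g4 : ∑ o ∈ O with R o (j, D.cls j e), I.setCost (D.N o.1 o.2) ≤
            3 * ∑ o ∈ O with R o (j, D.cls j e), D.cl o.1 := by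
          rw [Finset.mul_sum]
          exact Finset.sum_le_sum fun o _ => D.N_cost _ _
        linarith
    have hsplit : I.optCost (smallSet D.cl D.cls D.c X k j (D.cls j e)) ≤
        I.optCost (smallSet D.cl D.cls D.c Y k j (D.cls j e)) + 1 / 16 * D.cl j := by
      have g1 : smallSet D.cl D.cls D.c X k j (D.cls j e) ⊆
          smallSet D.cl D.cls D.c Y k j (D.cls j e) ∪
          smallSet D.cl D.cls D.c (X \ Y) k j (D.cls j e) := by
        intro f hf
        rw [mem_small] at hf
        rw [Finset.mem_union, mem_small, mem_small, Finset.mem_sdiff]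
        by_cases hfY : f ∈ Y
        · exact Or.inl ⟨hfY, hf.2⟩
        · exact Or.inr ⟨⟨hf.1, hfY⟩, hf.2⟩
      refine (opt_mono I g1).trans ((opt_union I _ _).trans (add_le_add le_rfl ?_))
      refine (opt_le_sum (D := D) _).trans ?_
      have g2 : ∀ f ∈ smallSet D.cl D.cls D.c (X \ Y) k j (D.cls j e), D.c f ≤ D.cl j / 2 ^ k := by
        intro f hf
        rw [le_div_iff₀ (by positivity)]
        exact (mem_small.mp hf).2.2.le
      refine (Finset.sum_le_card_nsmul _ _ _ g2).trans ?_
      rw [nsmul_eq_mul]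
      have g3 : ((smallSet D.cl D.cls D.c (X \ Y) k j (D.cls j e)).card : ℝ) ≤ 2 ^ k / 16 := by
        have : (smallSet D.cl D.cls D.c (X \ Y) k j (D.cls j e)).card ≤ (X \ Y).card :=
          Finset.card_le_card fun f hf => (mem_small.mp hf).1
        have g4 : 16 * (smallSet D.cl D.cls D.c (X \ Y) k j (D.cls j e)).card ≤ 2 ^ k := by omega
        have g5 : (16:ℝ) * (smallSet D.cl D.cls D.c (X \ Y) k j (D.cls j e)).card ≤ 2 ^ k := by
          exact_mod_cast g4
        linarith
      calc _ ≤ (2:ℝ) ^ k / 16 * (D.cl j / 2 ^ k) :=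
            mul_le_mul_of_nonneg_right g3 (div_nonneg (D.cl_pos j).le (by positivity))
        _ = 1 / 16 * D.cl j := by field_simp
    have hd' : 1 / 8 * D.cl j ≤ _ := hd
    linarith
  have key3 : ∑ v ∈ G, D.cl v.1 ≤ 48 * ∑ o ∈ O, D.cl o.1 := by
    refine (Finset.sum_le_sum key2).trans ?_
    rw [← Finset.mul_sum, Finset.sum_comm]
    refine mul_le_mul_of_nonneg_left (Finset.sum_le_sum fun o _ => ?_) (by norm_num)
    rw [← Finset.sum_filter, Finset.sum_const, nsmul_eq_mul]
    have : (G.filter fun v => R o v).card ≤ 1 := by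
      rw [Finset.card_le_one]
      have aux : ∀ e ∈ E, ∀ e' ∈ E, h e ≤ h e' → R o (h e, D.cls (h e) e) →
          R o (h e', D.cls (h e') e') → (h e, D.cls (h e) e) = (h e', D.cls (h e') e') := by
        rintro e he e' he' hle ⟨g1, f, g2, g3⟩ ⟨g1', f', g2', g3'⟩
        simp only at g1 g2 g3 g1' g2' g3'
        have a1 := D.lami _ (h e') f f' g1' (g2.trans g2'.symm)
        have a2 := D.lami _ (h e') f e hle g3
        have a3 : D.cls (h e') e = D.cls (h e') e' := by rw [← a2, a1, g3']
        rcases hle.lt_or_eq with hlt | heq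
        · refine absurd ?_ ((hh e he).2.2 _ hlt)
          rw [a3]; exact (hh e' he').2.1
        · rw [← heq] at a3
          rw [Prod.mk.injEq]
          exact ⟨heq, by rw [← heq]; exact a3⟩
      intro v hv v' hv'
      rw [Finset.mem_filter] at hv hv'
      obtain ⟨hv, hr⟩ := hv
      obtain ⟨hv', hr'⟩ := hv'
      obtain ⟨e, he, rfl⟩ := Finset.mem_image.mp hv
      obtain ⟨e', he', rfl⟩ := Finset.mem_image.mp hv'
      rcases le_total (h e) (h e') with hle | hle
      · exact aux e he e' he' hle hr hr'
      · exact (aux e' he' e he hle hr' hr).symm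
    have h1 : ((G.filter fun v => R o v).card : ℝ) ≤ 1 := by exact_mod_cast this
    nlinarith [D.cl_pos o.1]
  nlinarith

lemma lemY (H : AData D X K) (l : List (Fin n)) (hl : l.Nodup) (k : ℕ) (hk : k < K)
    (Y : Finset (Fin n)) (hYX : Y ⊆ X) (hcard : 16 * (X \ Y).card ≤ 2 ^ k) (t : ℕ) :
    ∀ A : Finset (Fin n), I.optCost A < H.lam * 2 ^ t →
    (∀ j b, dense I D.cl D.cls D.c X k j b → (∃ e ∈ A, D.cls j e = b) →
      smallSet D.cl D.cls D.c Y k j b ⊆ A) →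
    ∑ e ∈ A ∩ Y, D.ys l e ≤ 392 * Phi k * I.optCost A := by
  classical
  have hP := Phi_ge k
  induction t with
  | zero =>
    intro A hA _
    have : ∑ e ∈ A ∩ Y, D.ys l e = 0 := by
      refine Finset.sum_eq_zero fun e he => ?_
      have h1 := H.c_opt A e (Finset.mem_inter.mp he).1
      have h2 : D.c e ≤ 0 := by
        by_contra hcon
        have := H.c_lam e (not_le.mp hcon)
        rw [pow_zero, mul_one] at hA
        linarith
      linarith [D.ys_le l hl e, D.ys_nonneg l e]
    rw [this]
    have := opt_nonneg I A
    positivity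
  | succ t ih =>
    intro A hA hstar
    obtain ⟨O, tp, h1, h2, h3⟩ := H.hO' A
    rw [sum_ys_pos l hl]
    set A' := (A ∩ Y).filter fun e => 0 < D.c e with hA'
    have hA'm : ∀ e ∈ A', e ∈ A ∧ e ∈ Y ∧ 0 < D.c e := by
      intro e he
      simp only [hA', Finset.mem_filter, Finset.mem_inter] at he
      exact ⟨he.1.1, he.1.2, he.2⟩
    let P : Fin n → Prop := fun e =>
      ∃ j, tp e ≤ j ∧ dense I D.cl D.cls D.c X k j (D.cls j e)
    rw [← Finset.sum_filter_add_sum_filter_not A' P]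
    have hE1 := lemE1 H l k hk Y hYX hcard A hstar O tp h3 (A'.filter P) (by
      intro e he
      rw [Finset.mem_filter] at he
      exact ⟨(hA'm e he.1).1, (hA'm e he.1).2.2, he.2⟩)
    have hE2 : ∑ e ∈ A' with ¬ P e, D.ys l e ≤ 50 * Phi k * ∑ v ∈ O, D.cl v.1 := by
      rw [← Finset.sum_fiberwise_of_maps_to (t := O) (g := fun e => (tp e, D.cls (tp e) e))
        (fun e he => by
          have := hA'm e (Finset.mem_filter.mp he).1
          exact (h3 e this.1 this.2.2).1)]
      rw [Finset.mul_sum]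
      refine Finset.sum_le_sum ?_
      rintro ⟨j, b⟩ hv
      simp only
      set F := (A'.filter fun e => ¬ P e).filter (fun e => (tp e, D.cls (tp e) e) = (j, b)) with hF
      have hFm : ∀ e ∈ F, e ∈ Y ∧ ¬ P e ∧ tp e = j ∧ D.cls j e = b ∧ D.c e ≤ D.cl j := by
        intro e he
        rw [hF, Finset.mem_filter, Finset.mem_filter, Prod.mk.injEq] at he
        obtain ⟨⟨ha, hb⟩, hc, hd⟩ := he
        have := hA'm e ha
        have h4 := (h3 e this.1 this.2.2).2.1
        subst hc
        exact ⟨this.2.1, hb, rfl, hd, h4⟩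
      rw [← Finset.sum_filter_add_sum_filter_not F (fun e => D.cl j ≤ D.c e * 2 ^ k)]
      have hb := keyB (D := D) l j b k (F.filter fun e => D.cl j ≤ D.c e * 2 ^ k) (by
        intro e he
        rw [Finset.mem_filter] at he
        obtain ⟨_, _, _, h6, h7⟩ := hFm e he.1
        exact ⟨h6, h7, H.hbig k hk j e h7 he.2⟩)
      have hs : ∑ e ∈ F.filter (fun e => ¬ D.cl j ≤ D.c e * 2 ^ k), D.ys l e ≤
          49 * Phi k * D.cl j := by
        by_cases hne : F.Nonempty
        · obtain ⟨e, he⟩ := hne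
          obtain ⟨heY, hnP, htp, heb, hec⟩ := hFm e he
          have hnd : ∀ j', j ≤ j' → ¬ dense I D.cl D.cls D.c X k j' (D.cls j' e) :=
            fun j' hj' hd => hnP ⟨j', htp ▸ hj', hd⟩
          have hop : I.optCost (smallSet D.cl D.cls D.c X k j b) < 1 / 8 * D.cl j := by
            have := hnd j le_rfl
            rw [heb] at this
            exact not_le.mp this
          have hAv := ih (smallSet D.cl D.cls D.c X k j b) (by
              have := h2 _ hv
              rw [pow_succ] at hA
              simp only at this
              linarith [opt_nonneg I A]) (by
            rintro j' b' hd ⟨f, hf, rfl⟩ g hg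
            obtain ⟨hfX, hfb, hfc⟩ := mem_small.mp hf
            obtain ⟨hgY, hgb, hgc⟩ := mem_small.mp hg
            have hlt : j' < j := by
              by_contra hcon
              have hle := not_lt.mp hcon
              refine hnd j' hle ?_
              rw [D.lami j j' e f hle (heb.trans hfb.symm)]
              exact hd
            exact mem_small.mpr ⟨hYX hgY, (D.lami j' j g f hlt.le hgb).trans hfb,
              hgc.trans_le (D.cl_mono hlt.le)⟩)
          have hsub : F.filter (fun e => ¬ D.cl j ≤ D.c e * 2 ^ k) ⊆
              smallSet D.cl D.cls D.c X k j b ∩ Y := by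
            intro f hf
            rw [Finset.mem_filter, not_le] at hf
            obtain ⟨a1, a2, a3, a4, a5⟩ := hFm f hf.1
            exact Finset.mem_inter.mpr ⟨mem_small.mpr ⟨hYX a1, a4, hf.2⟩, a1⟩
          refine (Finset.sum_le_sum_of_subset_of_nonneg hsub fun i _ _ => D.ys_nonneg l i).trans ?_
          refine hAv.trans ?_
          have : 0 < Phi k := by linarith
          nlinarith
        · rw [Finset.not_nonempty_iff_eq_empty.mp hne]
          have := D.cl_pos j
          simp only [Finset.filter_empty, Finset.sum_empty]
          positivity
      linarith
    have : 0 < Phi k := by linarith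
    nlinarith

lemma lemFinal (H : AData D X K) (σ : List (Fin n)) (hσ : σ.Nodup) (k : ℕ) (hk : k < K)
    (h16 : 16 * predErr X σ ≤ 2 ^ k) :
    ∑ e, D.ys σ.reverse e ≤ 400 * Phi k * I.optCost σ.toFinset := by
  classical
  have hP := Phi_ge k
  have hl : σ.reverse.Nodup := List.nodup_reverse.mpr hσ
  have hz : ∑ e, D.ys σ.reverse e = ∑ e ∈ σ.toFinset, D.ys σ.reverse e := by
    symm
    refine Finset.sum_subset (Finset.subset_univ _) fun e _ he => D.ys_zero _ _ ?_
    simpa using he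
  have hn := opt_nonneg I σ.toFinset
  rw [hz]
  unfold predErr at h16
  rcases le_total σ.toFinset.card ((σ.toFinset \ X).card + (X \ σ.toFinset).card) with h | h
  · rw [min_eq_left h] at h16
    have := lemU H σ.reverse hl σ.toFinset k hk (by omega)
    nlinarith [mul_nonneg (by linarith : (0:ℝ) ≤ Phi k) hn]
  · rw [min_eq_right h] at h16
    have hu := lemU H σ.reverse hl (σ.toFinset \ X) k hk (by omega)
    have hm1 := opt_mono I (Finset.sdiff_subset : σ.toFinset \ X ⊆ σ.toFinset)
    have hm2 := opt_mono I (Finset.inter_subset_left : σ.toFinset ∩ X ⊆ σ.toFinset)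
    obtain ⟨t, ht⟩ := pow_unbounded_of_one_lt (I.optCost (σ.toFinset ∩ X) / H.lam)
      (one_lt_two : (1:ℝ) < 2)
    rw [div_lt_iff₀ H.lam_pos, mul_comm] at ht
    have hy := lemY H σ.reverse hl k hk (σ.toFinset ∩ X) Finset.inter_subset_right (by
      rw [Finset.sdiff_inter_self_right]; omega) t (σ.toFinset ∩ X) ht
      (fun j b _ _ f hf => (mem_small.mp hf).1)
    rw [Finset.inter_self] at hy
    rw [← Finset.sum_sdiff (Finset.inter_subset_left : σ.toFinset ∩ X ⊆ σ.toFinset),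
      Finset.sdiff_inter_self_left]
    have : 0 < Phi k := by linarith
    have b1 := mul_le_mul_of_nonneg_left hm1 this.le
    have b2 := mul_le_mul_of_nonneg_left hm2 this.le
    nlinarith

end HData

namespace HData

lemma uu_anti {a b : ℕ} (h : a ≤ b) : uu b ≤ uu a := by
  unfold uu
  have : (a:ℝ) ≤ b := by exact_mod_cast h
  apply one_div_le_one_div_of_le (by positivity)
  gcongr

lemma uu_sum (v M : ℕ) : ∑ j ∈ Finset.range M, (if v ≤ j then uu (j - v) else 0) =
    1 - 1 / (((M - v : ℕ) : ℝ) + 1) := by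
  induction M with
  | zero => simp
  | succ M ih =>
    rw [Finset.sum_range_succ, ih]
    split_ifs with h
    · rw [Nat.succ_sub h]
      unfold uu
      push_cast
      field_simp
      ring
    · have : M + 1 - v = 0 := by omega
      have h2 : M - v = 0 := by omega
      rw [this, h2]; simp

lemma uu_sum_le (v M : ℕ) : ∑ j ∈ Finset.range M, (if v ≤ j then uu (j - v) else 0) ≤ 1 := by
  rw [uu_sum]
  have : (0:ℝ) ≤ 1 / (((M - v : ℕ) : ℝ) + 1) := by positivity
  linarith

lemma uu_sum_le' (M : ℕ) : ∑ j ∈ Finset.range M, uu j ≤ 1 := by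
  simpa using uu_sum_le 0 M

lemma sum_biUnion_le' {ι α : Type*} [DecidableEq ι] [DecidableEq α] (s : Finset ι)
    (t : ι → Finset α) (f : α → ℝ) (hf : ∀ a, 0 ≤ f a) :
    ∑ a ∈ s.biUnion t, f a ≤ ∑ i ∈ s, ∑ a ∈ t i, f a := by
  induction s using Finset.induction_on with
  | empty => simp
  | insert i s hi ih =>
    rw [Finset.biUnion_insert, Finset.sum_insert hi]
    have h1 := Finset.sum_union_inter (s₁ := t i) (s₂ := s.biUnion t) (f := f)
    have h2 : 0 ≤ ∑ a ∈ t i ∩ s.biUnion t, f a := Finset.sum_nonneg fun a _ => hf a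
    linarith

lemma exists_lam (I : WPAPInstance n L) :
    ∃ lam : ℝ, 0 < lam ∧ ∀ ℓ, 0 < I.cost ℓ → lam ≤ I.cost ℓ := by
  classical
  by_cases h : (Finset.univ.filter fun ℓ => 0 < I.cost ℓ).Nonempty
  · obtain ⟨ℓ, h1, h2⟩ := Finset.exists_min_image _ I.cost h
    exact ⟨I.cost ℓ, (Finset.mem_filter.mp h1).2, fun ℓ' h' => h2 ℓ' (by simpa using h')⟩
  · refine ⟨1, one_pos, fun ℓ hℓ => absurd ⟨ℓ, by simpa using hℓ⟩ h⟩

lemma exists_lev (lam : ℝ) (hl : 0 < lam) : ∃ lev : ℝ → ℕ,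
    (∀ r j, lev r ≤ j ↔ r ≤ lam * 2 ^ j) ∧ ∀ r, lam ≤ r → lam * 2 ^ lev r ≤ 2 * r := by
  classical
  have hex : ∀ r : ℝ, ∃ j : ℕ, r ≤ lam * 2 ^ j := by
    intro r
    obtain ⟨t, ht⟩ := pow_unbounded_of_one_lt (r / lam) (one_lt_two : (1:ℝ) < 2)
    rw [div_lt_iff₀ hl, mul_comm] at ht
    exact ⟨t, ht.le⟩
  have h1 : ∀ r j, Nat.find (hex r) ≤ j ↔ r ≤ lam * 2 ^ j := by
    intro r j
    constructor
    · intro h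
      refine (Nat.find_spec (hex r)).trans ?_
      exact mul_le_mul_of_nonneg_left (pow_le_pow_right₀ (by norm_num) h) hl.le
    · intro h; exact Nat.find_min' _ h
  refine ⟨fun r => Nat.find (hex r), h1, ?_⟩
  intro r hr
  simp only
  rcases Nat.eq_zero_or_pos (Nat.find (hex r)) with h | h
  · rw [h]; linarith
  · obtain ⟨q, hq⟩ := Nat.exists_eq_succ_of_ne_zero h.ne'
    have : ¬ r ≤ lam * 2 ^ q := by rw [← h1]; omega
    rw [hq, Nat.succ_eq_add_one, pow_succ]
    linarith

lemma exists_data (I : WPAPInstance n L) (X : Finset (Fin n)) (K : ℕ) :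
    ∃ D : HData I, Nonempty (AData D X K) := by
  classical
  obtain ⟨lam, hl, hlam⟩ := exists_lam I
  obtain ⟨lev, hlev, hlev2⟩ := exists_lev lam hl
  have hml : ∀ e : Fin n, ∃ ℓ, (I.lo ℓ ≤ e ∧ e ≤ I.hi ℓ) ∧
      ∀ ℓ', I.lo ℓ' ≤ e ∧ e ≤ I.hi ℓ' → I.cost ℓ ≤ I.cost ℓ' := by
    intro e
    obtain ⟨ℓ0, h0⟩ := I.covered e
    obtain ⟨ℓ, h1, h2⟩ := Finset.exists_min_image
      (Finset.univ.filter fun ℓ => I.lo ℓ ≤ e ∧ e ≤ I.hi ℓ) I.cost ⟨ℓ0, by simpa using h0⟩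
    exact ⟨ℓ, (Finset.mem_filter.mp h1).2, fun ℓ' h' => h2 ℓ' (by simpa using h')⟩
  choose ml hml1 hml2 using hml
  obtain ⟨J, hJ⟩ : ∃ J : ℕ, ∀ ℓ, lev (I.cost ℓ) ≤ J :=
    ⟨Finset.univ.sup fun ℓ => lev (I.cost ℓ), fun ℓ =>
      Finset.le_sup (f := fun ℓ => lev (I.cost ℓ)) (Finset.mem_univ ℓ)⟩
  choose N0 hN0c hN0v using Sst_cover I lam hl
  let cl : Fin (J+1) → ℝ := fun j => lam * 2 ^ (j : ℕ)
  let cls : Fin (J+1) → Fin n → ℕ := fun j e => Sst I lam (j+1) e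
  let c : Fin n → ℝ := fun e => I.cost (ml e)
  have hclp : ∀ j, 0 < cl j := fun j => by positivity
  let N : Fin (J+1) → ℕ → Finset L := fun j b => N0 (j+1) b ∪
    if h : ∃ e : Fin n, (e : ℕ) = b ∧ c e ≤ cl j then {ml h.choose} else ∅
  let w : Fin (J+1) → Fin n → ℝ := fun j e =>
    (if lev (c e) ≤ j then uu (j - lev (c e)) else 0) +
      ∑ k ∈ Finset.range K, if isTop I cl cls c X k j e then uu k else 0
  have hw2 : ∀ j e, 0 ≤ ∑ k ∈ Finset.range K, if isTop I cl cls c X k j e then uu k else 0 :=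
    fun j e => Finset.sum_nonneg fun k _ => by split_ifs; exacts [(uu_pos k).le, le_rfl]
  have hw1 : ∀ (j : Fin (J+1)) e, 0 ≤ (if lev (c e) ≤ j then uu (j - lev (c e)) else 0) :=
    fun j e => by split_ifs; exacts [(uu_pos _).le, le_rfl]
  let D : HData I :=
    { m := J + 1
      cl := cl
      cl_pos := hclp
      cl_mono := fun i j h => mul_le_mul_of_nonneg_left
        (pow_le_pow_right₀ (by norm_num) h) hl.le
      cls := cls
      lami := fun j j' e f hj h => Sst_lam I lam (j+1) (j'+1) e f (Nat.succ_le_succ hj) h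
      c := c
      ml := ml
      ml_cov := hml1
      ml_cost := fun e => rfl
      N := N
      N_cost := by
        intro j b
        refine (setCost_union_le I _ _).trans ?_
        have h1 := hN0c (j+1) b
        have h2 : I.setCost (if h : ∃ e : Fin n, (e : ℕ) = b ∧ c e ≤ cl j
            then {ml h.choose} else ∅) ≤ cl j := by
          split_ifs with h
          · simpa [WPAPInstance.setCost] using h.choose_spec.2
          · simpa [WPAPInstance.setCost] using (hclp j).le
        rw [pow_succ] at h1
        have h3 : cl j = lam * 2 ^ (j:ℕ) := rfl
        nlinarith
      N_cov := by
        intro j e he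
        by_cases hb : (e : ℕ) = cls j e
        · have h : ∃ f : Fin n, (f : ℕ) = cls j e ∧ c f ≤ cl j := ⟨e, hb, he⟩
          refine ⟨ml h.choose, Finset.mem_union_right _ ?_, ?_⟩
          · rw [dif_pos h]; exact Finset.mem_singleton_self _
          · have : h.choose = e := Fin.ext (h.choose_spec.1.trans hb.symm)
            rw [this]; exact hml1 e
        · obtain ⟨ℓ, h1, h2⟩ := hN0v (j+1) (cls j e) e rfl hb
          exact ⟨ℓ, Finset.mem_union_left _ h1, h2⟩
      w := w
      w_nonneg := fun j e => add_nonneg (hw1 j e) (hw2 j e)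
      w_sum := by
        intro e
        simp only [w]
        rw [Finset.sum_add_distrib]
        have h1 := uu_sum_le (lev (c e)) (J+1)
        rw [← Fin.sum_univ_eq_sum_range
          (fun j => if lev (c e) ≤ j then uu (j - lev (c e)) else 0)] at h1
        have h2 : ∑ j : Fin (J+1), ∑ k ∈ Finset.range K,
            (if isTop I cl cls c X k j e then uu k else 0) ≤ 1 := by
          rw [Finset.sum_comm]
          refine le_trans (Finset.sum_le_sum fun k _ => ?_) (uu_sum_le' K)
          rw [← Finset.sum_filter, Finset.sum_const, nsmul_eq_mul]
          have : (Finset.univ.filter fun j => isTop I cl cls c X k j e).card ≤ 1 := by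
            rw [Finset.card_le_one]
            intro a ha b hb
            rw [Finset.mem_filter] at ha hb
            rcases lt_trichotomy a b with h | h | h
            · exact absurd hb.2.1 (ha.2.2 b h)
            · exact h
            · exact absurd ha.2.1 (hb.2.2 a h)
          have h3 : ((Finset.univ.filter fun j => isTop I cl cls c X k j e).card : ℝ) ≤ 1 := by
            exact_mod_cast this
          nlinarith [uu_pos k]
        linarith }
  refine ⟨D, ⟨(0 : Fin (J+1)), lam, hl, fun e he => hlam _ he, ?_, ?_, ?_, ?_⟩⟩
  · intro A e he
    obtain ⟨T, h1, h2⟩ := opt_att I A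
    obtain ⟨ℓ, hℓ, h3⟩ := h1 e he
    rw [h2]
    exact (hml2 e ℓ h3).trans (Finset.single_le_sum (f := I.cost) (fun i _ => I.cost_nonneg i) hℓ)
  · intro A
    obtain ⟨T, h1, h2⟩ := opt_att I A
    rw [h2]
    let jl : L → Fin (J+1) := fun ℓ => ⟨lev (I.cost ℓ), Nat.lt_succ_of_le (hJ ℓ)⟩
    have hjl : ∀ ℓ, I.cost ℓ ≤ cl (jl ℓ) := fun ℓ => (hlev _ _).mp le_rfl
    have hjl2 : ∀ ℓ, 0 < I.cost ℓ → cl (jl ℓ) ≤ 2 * I.cost ℓ := fun ℓ h => hlev2 _ (hlam ℓ h)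
    let O : Finset (Fin (J+1) × ℕ) := (T.filter fun ℓ => 0 < I.cost ℓ).biUnion fun ℓ =>
      ((Finset.univ.filter fun e : Fin n => I.lo ℓ ≤ e ∧ e ≤ I.hi ℓ).image
        fun e : Fin n => cls (jl ℓ) e).image fun b => (jl ℓ, b)
    refine ⟨O, ?_, ?_, ?_⟩
    · refine (sum_biUnion_le' _ _ (fun v : Fin (J+1) × ℕ => cl v.1) fun v => (hclp _).le).trans ?_
      have : ∀ ℓ ∈ T.filter (fun ℓ => 0 < I.cost ℓ),
          ∑ v ∈ ((Finset.univ.filter fun e : Fin n => I.lo ℓ ≤ e ∧ e ≤ I.hi ℓ).image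
        fun e : Fin n => cls (jl ℓ) e).image (fun b => (jl ℓ, b)), cl v.1 ≤ 4 * I.cost ℓ := by
        intro ℓ hℓ
        have hp := (Finset.mem_filter.mp hℓ).2
        have hcard := (Finset.card_image_le (f := fun b => (jl ℓ, b))).trans
          (Sst_meet I lam (jl ℓ) ℓ (hjl ℓ))
        have hle := Finset.sum_le_card_nsmul (((Finset.univ.filter fun e : Fin n =>
          I.lo ℓ ≤ e ∧ e ≤ I.hi ℓ).image
          fun e : Fin n => cls (jl ℓ) e).image (fun b => (jl ℓ, b))) (fun v => cl v.1)
          (cl (jl ℓ)) (by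
            intro v hv
            obtain ⟨b, _, rfl⟩ := Finset.mem_image.mp hv
            exact le_rfl)
        refine hle.trans ?_
        rw [nsmul_eq_mul]
        have h5 : ((((Finset.univ.filter fun e : Fin n =>
          I.lo ℓ ≤ e ∧ e ≤ I.hi ℓ).image
          fun e : Fin n => cls (jl ℓ) e).image (fun b => (jl ℓ, b))).card : ℝ) ≤ 2 := by
          exact_mod_cast hcard
        nlinarith [hjl2 ℓ hp, hclp (jl ℓ)]
      refine (Finset.sum_le_sum this).trans ?_
      rw [← Finset.mul_sum]
      refine mul_le_mul_of_nonneg_left ?_ (by norm_num)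
      exact Finset.sum_le_sum_of_subset_of_nonneg (Finset.filter_subset _ _)
        fun i _ _ => I.cost_nonneg i
    · intro v hv
      obtain ⟨ℓ, hℓ, hv⟩ := Finset.mem_biUnion.mp hv
      obtain ⟨b, _, rfl⟩ := Finset.mem_image.mp hv
      obtain ⟨hT, hp⟩ := Finset.mem_filter.mp hℓ
      refine (hjl2 ℓ hp).trans (mul_le_mul_of_nonneg_left ?_ (by norm_num))
      exact Finset.single_le_sum (f := I.cost) (fun i _ => I.cost_nonneg i) hT
    · intro e he hc
      obtain ⟨ℓ, hℓ, h3⟩ := h1 e he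
      have hm := hml2 e ℓ h3
      refine ⟨jl ℓ, ?_, hm.trans (hjl ℓ)⟩
      refine Finset.mem_biUnion.mpr ⟨ℓ, Finset.mem_filter.mpr ⟨hℓ, lt_of_lt_of_le hc hm⟩, ?_⟩
      exact Finset.mem_image_of_mem _ (Finset.mem_image_of_mem _
        (Finset.mem_filter.mpr ⟨Finset.mem_univ _, h3⟩))
  · intro k _ (j : Fin (J+1)) e h1 h2
    have h3 : lev (c e) ≤ j := (hlev _ _).mpr h1
    have h4 : (j : ℕ) - lev (c e) ≤ k := by
      have h5 : c e ≤ lam * 2 ^ lev (c e) := (hlev _ _).mp le_rfl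
      have h6 : lam * 2 ^ (j:ℕ) ≤ lam * 2 ^ (lev (c e) + k) := by
        refine le_trans h2 ?_
        rw [pow_add, ← mul_assoc]
        exact mul_le_mul_of_nonneg_right h5 (by positivity)
      have h7 := le_of_mul_le_mul_left h6 hl
      have := (pow_le_pow_iff_right₀ (one_lt_two : (1:ℝ) < 2)).mp h7
      omega
    refine (uu_anti h4).trans ?_
    have h5 : uu (j - lev (c e)) = (if lev (c e) ≤ j then uu (j - lev (c e)) else 0) :=
      (if_pos h3).symm
    rw [h5]
    exact le_add_of_nonneg_right (hw2 j e)
  · intro k hk (j : Fin (J+1)) e h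
    have h5 := Finset.single_le_sum (s := Finset.range K)
      (f := fun k => if isTop I cl cls c X k j e then uu k else 0)
      (fun k _ => by split_ifs; exacts [(uu_pos k).le, le_rfl]) (Finset.mem_range.mpr hk)
    rw [if_pos (show isTop I cl cls c X k j e from h)] at h5
    exact h5.trans (le_add_of_nonneg_left (hw1 j e))

lemma Phi_bound (h : ℕ) :
    Phi (Nat.log 2 (h + 1) + 6) ≤ 40 * (1 + Real.log (1 + Real.log (1 + (h : ℝ)))) := by
  set q := Nat.log 2 (h+1) with hq
  set x := Real.log (1 + (h:ℝ)) with hx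
  have hx0 : 0 ≤ x := Real.log_nonneg (by linarith [(Nat.cast_nonneg h : (0:ℝ) ≤ h)])
  have hqx : (q : ℝ) ≤ 2 * x := by
    have h1 : 2 ^ q ≤ h + 1 := Nat.pow_log_le_self 2 (by omega)
    have h2 : (2:ℝ) ^ q ≤ 1 + h := by
      have : ((2 ^ q : ℕ) : ℝ) ≤ ((h + 1 : ℕ) : ℝ) := by exact_mod_cast h1
      push_cast at this; linarith
    have h3 := Real.log_le_log (by positivity) h2
    rw [Real.log_pow] at h3
    have h4 := Real.log_two_gt_d9
    have : (0:ℝ) ≤ q := Nat.cast_nonneg q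
    nlinarith
  have hq0 : (0:ℝ) ≤ q := Nat.cast_nonneg q
  have e1 : (1 + uu (q+6)) / uu (q+6) ≤ (9 * (1 + x)) ^ 2 := by
    have : (1 + uu (q+6)) / uu (q+6) = 1 + ((q:ℝ) + 7) * (q + 8) := by
      unfold uu; push_cast; field_simp; ring
    rw [this]
    nlinarith
  have e2 := Real.log_le_log (by have := uu_pos (q+6); positivity) e1
  rw [Real.log_pow, Real.log_mul (by norm_num) (by positivity)] at e2
  have e3 : Real.log 9 ≤ 8 := by
    have := Real.log_le_sub_one_of_pos (show (0:ℝ) < 9 by norm_num)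
    linarith
  have e4 : 0 ≤ Real.log (1 + x) := Real.log_nonneg (by linarith)
  unfold Phi
  push_cast at e2
  linarith

end HData

theorem stmt11 :
    ∃ C : ℝ, 0 < C ∧
      ∀ (n : ℕ) (L : Type) [Fintype L] [DecidableEq L], 1 ≤ n →
        ∀ (I : WPAPInstance n L) (Xhat : Finset (Fin n)),
          ∃ μ : PMF (List (Fin n) → Finset L),
            (∀ A ∈ μ.support, I.IsOnlineAlg A) ∧
            ∀ σ : List (Fin n), σ.Nodup →
              (∑' A : List (Fin n) → Finset L, (μ A).toReal * I.setCost (A σ)) ≤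
                C * (1 + Real.log (1 + Real.log (1 + (predErr Xhat σ : ℝ)))) *
                  I.optCost σ.toFinset := by
  refine ⟨160000, by norm_num, ?_⟩
  intro n L _ _ hn I Xhat
  obtain ⟨D, ⟨H⟩⟩ := HData.exists_data I Xhat (n + 8)
  obtain ⟨μ, h1, h2⟩ := D.exists_alg
  refine ⟨μ, h1, fun σ hσ => (h2 σ hσ).trans ?_⟩
  set h := predErr Xhat σ with hh
  have hle : h ≤ n := by
    have a1 : σ.toFinset.card ≤ n := by simpa using Finset.card_le_univ σ.toFinset
    exact (min_le_left _ _).trans a1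
  have hk : Nat.log 2 (h + 1) + 6 < n + 8 := by
    have : Nat.log 2 (h + 1) < h + 1 := Nat.log_lt_self 2 (by omega)
    omega
  have h16 : 16 * h ≤ 2 ^ (Nat.log 2 (h + 1) + 6) := by
    have := Nat.lt_pow_succ_log_self (b := 2) (by norm_num) (h + 1)
    rw [Nat.succ_eq_add_one, pow_succ] at this
    rw [pow_add]
    omega
  have h3 := HData.lemFinal H σ hσ _ hk h16
  have h4 := HData.Phi_bound h
  have h5 := HData.opt_nonneg I σ.toFinset
  have h6 := mul_le_mul_of_nonneg_right h4 h5
  linarith
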